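/- Let q ≥ 2 be an integer and δ ∈ (0,1/2). Then A(q,δ) ≤ K(δ²q + q^{3/5}(log q)^{4/5}), where K is a constant depending only on f₁ and f₂ (i.e. on the curve). -/

import Mathlib

open Set Real

/-- Distance from a real number to the nearest integer. -/
noncomputable def nint (y : ℝ) : ℝ := |y - round y|

/-- The standard additive character `x ↦ exp (2 * π * i * x)` of the reals. -/
noncomputable def unitExp (x : ℝ) : ℂ := Complex.exp ((2 * π * x : ℝ) * Complex.I)

lemma unitExp_add (x y : ℝ) : unitExp (x + y) = unitExp x * unitExp y := by
  rw [unitExp, unitExp, unitExp, ← Complex.exp_add]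
  congr 1
  push_cast
  ring

lemma norm_unitExp (x : ℝ) : ‖unitExp x‖ = 1 := Complex.norm_exp_ofReal_mul_I _

lemma unitExp_neg (x : ℝ) : unitExp (-x) = (starRingEnd ℂ) (unitExp x) := by
  rw [unitExp, unitExp, ← Complex.exp_conj]
  congr 1
  rw [map_mul, Complex.conj_ofReal, Complex.conj_I]
  push_cast
  ring

lemma unitExp_intCast (l : ℤ) : unitExp l = 1 := by
  rw [unitExp, ← Complex.exp_int_mul_two_pi_mul_I l]
  congr 1
  push_cast
  ring

lemma unitExp_sub_intCast (x : ℝ) (l : ℤ) : unitExp (x - l) = unitExp x := by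
  rw [sub_eq_add_neg, unitExp_add, ← Int.cast_neg, unitExp_intCast, mul_one]

lemma unitExp_re (x : ℝ) : (unitExp x).re = cos (2 * π * x) :=
  Complex.exp_ofReal_mul_I_re _

lemma norm_sum_unitExp_neg {ι : Type*} (s : Finset ι) (φ : ι → ℝ) :
    ‖∑ n ∈ s, unitExp (-φ n)‖ = ‖∑ n ∈ s, unitExp (φ n)‖ := by
  simp_rw [unitExp_neg, ← map_sum]
  exact RCLike.norm_conj _

lemma norm_sum_unitExp_le_card {ι : Type*} (s : Finset ι) (φ : ι → ℝ) :
    ‖∑ n ∈ s, unitExp (φ n)‖ ≤ s.card := by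
  refine (norm_sum_le _ _).trans ?_
  simp [norm_unitExp]

/-- The factor `1 / (1 - exp (2 * π * i * y))`, in terms of the tangent. -/
lemma unitExp_mul_one_sub {y : ℝ} (hy : sin (π * y) ≠ 0) :
    (1 / 2 - (tan (π * y - π / 2) / 2 : ℝ) * Complex.I) * (1 - unitExp y) = 1 := by
  have h1 : tan (π * y - π / 2) = -(cos (π * y) / sin (π * y)) := by
    rw [tan_eq_sin_div_cos, sin_sub_pi_div_two, cos_sub_pi_div_two, neg_div]
  have h2 : unitExp y = (2 * cos (π * y) ^ 2 - 1 : ℝ) +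
      (2 * sin (π * y) * cos (π * y) : ℝ) * Complex.I := by
    rw [unitExp, Complex.exp_mul_I, ← Complex.ofReal_cos, ← Complex.ofReal_sin,
      ← cos_two_mul, ← sin_two_mul]
    ring_nf
  have h3 := sin_sq_add_cos_sq (π * y)
  rw [h1, h2]
  set s := sin (π * y)
  set c := cos (π * y)
  have h4 : (s : ℂ) ^ 2 + (c : ℂ) ^ 2 = 1 := by exact_mod_cast h3
  have h5 : (s : ℂ) ≠ 0 := by exact_mod_cast hy
  push_cast
  field_simp
  linear_combination -2 * (c : ℂ) * Complex.I * h4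
    - 2 * s * c ^ 2 * Complex.I_sq

lemma abs_tan_le {θ y : ℝ} (hθ : 0 < θ) (h : 2 * θ ≤ sin (π * y)) :
    |tan (π * y - π / 2)| ≤ 1 / (2 * θ) := by
  rw [tan_eq_sin_div_cos, sin_sub_pi_div_two, cos_sub_pi_div_two, abs_div, abs_neg,
    abs_of_pos (a := sin (π * y)) (by linarith)]
  gcongr
  exact abs_cos_le_one _

lemma two_mul_le_sin_pi_mul {θ y : ℝ} (hθ : 0 ≤ θ) (h1 : θ ≤ y) (h2 : y ≤ 1 - θ) :
    2 * θ ≤ sin (π * y) := by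
  have hπ := pi_pos
  rcases le_total y (1 / 2) with h | h
  · have := mul_le_sin (x := π * y) (by nlinarith) (by nlinarith)
    have e : 2 / π * (π * y) = 2 * y := by field_simp
    linarith
  · have := mul_le_sin (x := π * (1 - y)) (by nlinarith) (by nlinarith)
    have e : 2 / π * (π * (1 - y)) = 2 * (1 - y) := by field_simp
    have e2 : sin (π * (1 - y)) = sin (π * y) := by
      rw [mul_sub, mul_one, sin_pi_sub]
    linarith

lemma kuzmin_landau_range {φ : ℕ → ℝ} {θ : ℝ} (hθ : 0 < θ) (N : ℕ)
    (hmono : ∀ n < N, φ (n + 1) - φ n ≤ φ (n + 2) - φ (n + 1))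
    (hl : ∀ n ≤ N, θ ≤ φ (n + 1) - φ n) (hu : ∀ n ≤ N, φ (n + 1) - φ n ≤ 1 - θ) :
    ‖∑ n ∈ Finset.range (N + 1), unitExp (φ n)‖ ≤ 1 + 1 / θ := by
  set t : ℕ → ℝ := fun n => tan (π * (φ (n + 1) - φ n) - π / 2) with ht
  set c : ℕ → ℂ := fun n => 1 / 2 - (t n / 2 : ℝ) * Complex.I with hc
  have hsin : ∀ n ≤ N, 2 * θ ≤ sin (π * (φ (n + 1) - φ n)) := fun n hn =>
    two_mul_le_sin_pi_mul hθ.le (hl n hn) (hu n hn)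
  have hE : ∀ n ≤ N, c n * (unitExp (φ n) - unitExp (φ (n + 1))) = unitExp (φ n) := by
    intro n hn
    have h1 := unitExp_mul_one_sub (y := φ (n + 1) - φ n)
      (by have := hsin n hn; intro h; linarith)
    have h2 : unitExp (φ (n + 1)) = unitExp (φ n) * unitExp (φ (n + 1) - φ n) := by
      rw [← unitExp_add]; ring_nf
    rw [h2]
    linear_combination unitExp (φ n) * h1
  have htn : ∀ n ≤ N, |t n| ≤ 1 / (2 * θ) := fun n hn => abs_tan_le hθ (hsin n hn)
  have htmono : ∀ n < N, t n ≤ t (n + 1) := by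
    intro n hn
    have hπ := pi_pos
    have a1 := hl n hn.le
    have a2 := hu n hn.le
    have a3 := hl (n + 1) hn
    have a4 := hu (n + 1) hn
    refine strictMonoOn_tan.monotoneOn ⟨?_, ?_⟩ ⟨?_, ?_⟩ ?_
    · nlinarith
    · nlinarith
    · nlinarith
    · nlinarith
    · have := mul_le_mul_of_nonneg_left (hmono n hn) hπ.le
      linarith
  have hcn : ∀ n ≤ N, ‖c n‖ ≤ 1 / 2 + 1 / (4 * θ) := by
    intro n hn
    refine (norm_sub_le _ _).trans ?_
    rw [norm_mul, Complex.norm_I, mul_one, Complex.norm_real, norm_div, norm_div, Real.norm_eq_abs]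
    have := htn n hn
    have e : 1 / (4 * θ) = 1 / (2 * θ) / 2 := by field_simp; norm_num
    rw [e]
    norm_num
    norm_num at this
    linarith
  have key : ∀ M ≤ N, ‖∑ n ∈ Finset.range (M + 1), unitExp (φ n) + c M * unitExp (φ (M + 1))‖
      ≤ ‖c 0‖ + (t M - t 0) / 2 := by
    intro M
    induction M with
    | zero =>
      intro _
      have h := hE 0 (Nat.zero_le _)
      have : ∑ n ∈ Finset.range (0 + 1), unitExp (φ n) + c 0 * unitExp (φ (0 + 1))
          = c 0 * unitExp (φ 0) := by
        rw [zero_add, Finset.sum_range_one]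
        rw [zero_add] at h
        linear_combination -h
      rw [this, norm_mul, norm_unitExp]
      simp
    | succ M ih =>
      intro hM
      have h := hE (M + 1) hM
      have e : ∑ n ∈ Finset.range (M + 1 + 1), unitExp (φ n)
            + c (M + 1) * unitExp (φ (M + 1 + 1))
          = (∑ n ∈ Finset.range (M + 1), unitExp (φ n) + c M * unitExp (φ (M + 1)))
            + (c (M + 1) - c M) * unitExp (φ (M + 1)) := by
        rw [Finset.sum_range_succ]
        linear_combination -h
      have e2 : ‖(c (M + 1) - c M) * unitExp (φ (M + 1))‖ = (t (M + 1) - t M) / 2 := by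
        rw [norm_mul, norm_unitExp, mul_one]
        have : c (M + 1) - c M = (-((t (M + 1) - t M) / 2) : ℝ) * Complex.I := by
          simp only [hc]
          push_cast
          ring
        rw [this, norm_mul, Complex.norm_I, mul_one, Complex.norm_real, norm_neg, norm_div,
          Real.norm_eq_abs, abs_of_nonneg (by linarith [htmono M hM])]
        norm_num
      rw [e]
      refine (norm_add_le _ _).trans ?_
      rw [e2]
      linarith [ih (by omega)]
  have h1 := key N le_rfl
  have h2 : ‖c N * unitExp (φ (N + 1))‖ ≤ 1 / 2 + 1 / (4 * θ) := by
    rw [norm_mul, norm_unitExp, mul_one]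
    exact hcn N le_rfl
  have h3 := hcn 0 (Nat.zero_le _)
  have h4 := abs_le.1 (htn N le_rfl)
  have h5 := abs_le.1 (htn 0 (Nat.zero_le _))
  have h6 := norm_le_norm_add_norm_sub' (∑ n ∈ Finset.range (N + 1), unitExp (φ n))
    (-(c N * unitExp (φ (N + 1))))
  rw [norm_neg, sub_neg_eq_add] at h6
  have e : 1 / (4 * θ) = 1 / θ / 4 := by field_simp
  have e' : 1 / (2 * θ) = 1 / θ / 2 := by field_simp
  rw [e] at h2 h3
  rw [e'] at h4 h5
  linarith

/-- The Kuzmin–Landau inequality. -/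
lemma kuzmin_landau {φ : ℕ → ℝ} {θ : ℝ} (hθ : 0 < θ) (a b : ℕ) (l : ℤ)
    (hmono : ∀ n ∈ Finset.Ico a b, φ (n + 1) - φ n ≤ φ (n + 2) - φ (n + 1))
    (hl : ∀ n ∈ Finset.Ico a b, l + θ ≤ φ (n + 1) - φ n)
    (hu : ∀ n ∈ Finset.Ico a b, φ (n + 1) - φ n ≤ l + 1 - θ) :
    ‖∑ n ∈ Finset.Ico a b, unitExp (φ n)‖ ≤ 1 + 1 / θ := by
  rcases le_or_gt b a with hab | hab
  · rw [Finset.Ico_eq_empty (by omega)]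
    simp only [Finset.sum_empty, norm_zero]
    positivity
  obtain ⟨N, rfl⟩ : ∃ N, b = a + (N + 1) := ⟨b - a - 1, by omega⟩
  simp only [Finset.mem_Ico] at hmono hl hu
  rw [Finset.sum_Ico_eq_sum_range, Nat.add_sub_cancel_left]
  have h := kuzmin_landau_range (φ := fun n => φ (a + n) - (l * n : ℤ)) hθ N
    (fun n hn => by
      have := hmono (a + n) (by omega)
      simp only [← add_assoc]
      push_cast
      linarith)
    (fun n hn => by
      have := hl (a + n) (by omega)
      simp only [← add_assoc]
      push_cast
      linarith)
    (fun n hn => by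
      have := hu (a + n) (by omega)
      simp only [← add_assoc]
      push_cast
      linarith)
  simpa only [unitExp_sub_intCast] using h

lemma exists_monotone_cut {s : ℕ → ℝ} {a b : ℕ} (hab : a ≤ b)
    (hs : ∀ n ∈ Finset.Ico a b, s n ≤ s (n + 1)) (u : ℝ) :
    ∃ c, a ≤ c ∧ c ≤ b ∧ (∀ n ∈ Finset.Ico a c, s n < u) ∧ ∀ n ∈ Finset.Ico c b, u ≤ s n := by
  induction b, hab using Nat.le_induction with
  | base => exact ⟨a, le_rfl, le_rfl, by simp, by simp⟩
  | succ b hab ih =>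
    simp only [Finset.mem_Ico] at *
    obtain ⟨c, h1, h2, h3, h4⟩ := ih fun n hn => hs n ⟨hn.1, by omega⟩
    rcases h2.eq_or_lt with rfl | hcb
    · rcases lt_or_ge (s c) u with h | h
      · refine ⟨c + 1, by omega, le_rfl, fun n hn => ?_, fun n hn => by omega⟩
        rcases (show n ≤ c by omega).eq_or_lt with rfl | hn'
        · exact h
        · exact h3 n ⟨hn.1, hn'⟩
      · refine ⟨c, h1, by omega, h3, fun n hn => ?_⟩
        obtain rfl : n = c := by omega
        exact h
    · refine ⟨c, h1, by omega, h3, fun n hn => ?_⟩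
      rcases (show n ≤ b by omega).eq_or_lt with rfl | hn'
      · obtain ⟨m, rfl⟩ : ∃ m, n = m + 1 := ⟨n - 1, by omega⟩
        exact (h4 m ⟨by omega, by omega⟩).trans (hs m ⟨by omega, by omega⟩)
      · exact h4 n ⟨hn.1, hn'⟩

lemma mul_le_sub_of_forall_le {s : ℕ → ℝ} {a b : ℕ} {μ : ℝ} (hab : a ≤ b)
    (hs : ∀ n ∈ Finset.Ico a b, μ ≤ s (n + 1) - s n) : ((b : ℝ) - a) * μ ≤ s b - s a := by
  induction b, hab using Nat.le_induction with
  | base => simp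
  | succ b hab ih =>
    simp only [Finset.mem_Ico] at *
    have h1 := ih fun n hn => hs n ⟨hn.1, by omega⟩
    have h2 := hs b ⟨hab, by omega⟩
    push_cast
    linarith

/-- A sequence with gaps at least `μ` has few terms in a short interval. -/
lemma card_Ico_le_of_gap {s : ℕ → ℝ} {a b : ℕ} {μ u v : ℝ} (hμ : 0 < μ) (huv : u ≤ v)
    (hs : ∀ n ∈ Finset.Ico a b, μ ≤ s (n + 1) - s n)
    (hu : ∀ n ∈ Finset.Ico a b, u ≤ s n) (hv : ∀ n ∈ Finset.Ico a b, s n ≤ v) :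
    ((Finset.Ico a b).card : ℝ) ≤ (v - u) / μ + 1 := by
  rcases le_or_gt b a with hab | hab
  · rw [Finset.Ico_eq_empty (by omega)]
    simp only [Finset.card_empty, Nat.cast_zero]
    have : 0 ≤ (v - u) / μ := div_nonneg (by linarith) hμ.le
    linarith
  obtain ⟨c, rfl⟩ : ∃ c, b = c + 1 := ⟨b - 1, by omega⟩
  simp only [Finset.mem_Ico] at *
  have h1 := mul_le_sub_of_forall_le (s := s) (a := a) (b := c) (μ := μ) (by omega)
    (fun n hn => by
      rw [Finset.mem_Ico] at hn
      exact hs n ⟨hn.1, by omega⟩)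
  have h2 := hu a (by omega)
  have h3 := hv c (by omega)
  rw [Nat.card_Ico, Nat.cast_sub (by omega)]
  push_cast
  have : ((c : ℝ) - a) ≤ (v - u) / μ := by
    rw [le_div_iff₀ hμ]
    linarith
  linarith

lemma norm_sum_unitExp_split_le (φ : ℕ → ℝ) {a b c : ℕ} (h1 : a ≤ c) (h2 : c ≤ b) :
    ‖∑ n ∈ Finset.Ico a b, unitExp (φ n)‖ ≤
      ‖∑ n ∈ Finset.Ico a c, unitExp (φ n)‖ + ‖∑ n ∈ Finset.Ico c b, unitExp (φ n)‖ := by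
  rw [← Finset.sum_Ico_consecutive _ h1 h2]
  exact norm_add_le _ _

lemma norm_sum_unitExp_le_of_floor_eq {φ : ℕ → ℝ} {ν : ℝ} (hν : 0 < ν) (hν1 : ν ≤ 1) {a b : ℕ}
    (l : ℤ)
    (hs : ∀ n ∈ Finset.Ico a b, ν ^ 2 ≤ (φ (n + 2) - φ (n + 1)) - (φ (n + 1) - φ n))
    (hl : ∀ n ∈ Finset.Ico a b, l ≤ φ (n + 1) - φ n)
    (hu : ∀ n ∈ Finset.Ico a b, φ (n + 1) - φ n < l + 1) :
    ‖∑ n ∈ Finset.Ico a b, unitExp (φ n)‖ ≤ 7 / ν := by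
  have hν2 : 0 < ν ^ 2 := by positivity
  have h1ν : 1 ≤ 1 / ν := by rw [le_div_iff₀ hν]; linarith
  have e1 : ν / 2 / ν ^ 2 = 1 / ν / 2 := by field_simp
  have e2 : 1 / (ν / 2) = 2 * (1 / ν) := by field_simp
  have e3 : 7 / ν = 7 * (1 / ν) := by field_simp
  rcases le_or_gt b a with hab | hab
  · rw [Finset.Ico_eq_empty (by omega)]
    simp only [Finset.sum_empty, norm_zero]
    positivity
  simp only [Finset.mem_Ico] at hs hl hu
  set g : ℕ → ℝ := fun n => φ (n + 1) - φ n with hg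
  obtain ⟨c, hc1, hc2, hc3, hc4⟩ := exists_monotone_cut (s := g) hab.le
    (fun n hn => by
      rw [Finset.mem_Ico] at hn
      have := hs n hn
      simp only [hg, add_assoc, Nat.reduceAdd]
      linarith) (l + ν / 2)
  obtain ⟨d, hd1, hd2, hd3, hd4⟩ := exists_monotone_cut (s := g) hc2
    (fun n hn => by
      rw [Finset.mem_Ico] at hn
      have := hs n ⟨by omega, by omega⟩
      simp only [hg, add_assoc, Nat.reduceAdd]
      linarith) (l + 1 - ν / 2)
  have b1 : ‖∑ n ∈ Finset.Ico a c, unitExp (φ n)‖ ≤ 1 / ν / 2 + 1 := by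
    refine (norm_sum_unitExp_le_card _ _).trans ?_
    have := card_Ico_le_of_gap (s := g) (a := a) (b := c) (u := l) (v := l + ν / 2) hν2
      (by linarith) (fun n hn => hs n (by rw [Finset.mem_Ico] at hn; omega))
      (fun n hn => hl n (by rw [Finset.mem_Ico] at hn; omega)) (fun n hn => (hc3 n hn).le)
    rwa [add_sub_cancel_left, e1] at this
  have b2 : ‖∑ n ∈ Finset.Ico c d, unitExp (φ n)‖ ≤ 1 + 2 * (1 / ν) := by
    rw [← e2]
    refine kuzmin_landau (by positivity) c d l (fun n hn => ?_) (fun n hn => ?_)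
      (fun n hn => (hd3 n hn).le)
    · have := hs n (by rw [Finset.mem_Ico] at hn; omega)
      linarith
    · exact hc4 n (by rw [Finset.mem_Ico] at *; omega)
  have b3 : ‖∑ n ∈ Finset.Ico d b, unitExp (φ n)‖ ≤ 1 / ν / 2 + 1 := by
    refine (norm_sum_unitExp_le_card _ _).trans ?_
    have := card_Ico_le_of_gap (s := g) (a := d) (b := b) (u := l + 1 - ν / 2) (v := l + 1) hν2
      (by linarith) (fun n hn => hs n (by rw [Finset.mem_Ico] at hn; omega))
      hd4 (fun n hn => (hu n (by rw [Finset.mem_Ico] at hn; omega)).le)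
    rwa [sub_sub_cancel, e1] at this
  have h1 := norm_sum_unitExp_split_le φ hc1 hc2
  have h2 := norm_sum_unitExp_split_le φ hd1 hd2
  linarith

lemma norm_sum_unitExp_le_of_slope_range {φ : ℕ → ℝ} {ν : ℝ} (hν : 0 < ν) (hν1 : ν ≤ 1) (M : ℕ) :
    ∀ {a b : ℕ} (l : ℤ),
    (∀ n ∈ Finset.Ico a b, ν ^ 2 ≤ (φ (n + 2) - φ (n + 1)) - (φ (n + 1) - φ n)) →
    (∀ n ∈ Finset.Ico a b, l ≤ φ (n + 1) - φ n) →
    (∀ n ∈ Finset.Ico a b, φ (n + 1) - φ n < l + M) →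
    ‖∑ n ∈ Finset.Ico a b, unitExp (φ n)‖ ≤ M * (7 / ν) := by
  induction M with
  | zero =>
    intro a b l _ hl hu
    rcases le_or_gt b a with hab | hab
    · rw [Finset.Ico_eq_empty (by omega)]
      simp
    · have h1 := hl a (Finset.mem_Ico.2 ⟨le_rfl, hab⟩)
      have h2 := hu a (Finset.mem_Ico.2 ⟨le_rfl, hab⟩)
      simp at h2
      linarith
  | succ M ih =>
    intro a b l hs hl hu
    rcases le_or_gt b a with hab | hab
    · rw [Finset.Ico_eq_empty (by omega)]
      simp only [Finset.sum_empty, norm_zero]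
      positivity
    simp only [Finset.mem_Ico] at hs hl hu
    obtain ⟨c, hc1, hc2, hc3, hc4⟩ := exists_monotone_cut (s := fun n => φ (n + 1) - φ n) hab.le
      (fun n hn => by
        rw [Finset.mem_Ico] at hn
        have := hs n hn
        simp only [add_assoc, Nat.reduceAdd]
        nlinarith) (l + 1)
    have b1 := norm_sum_unitExp_le_of_floor_eq (φ := φ) hν hν1 (a := a) (b := c) l
      (fun n hn => hs n (by rw [Finset.mem_Ico] at hn; omega))
      (fun n hn => hl n (by rw [Finset.mem_Ico] at hn; omega)) hc3
    have b2 := ih (a := c) (b := b) (l + 1)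
      (fun n hn => hs n (by rw [Finset.mem_Ico] at hn; omega))
      (fun n hn => by push_cast; exact hc4 n hn)
      (fun n hn => by
        have := hu n (by rw [Finset.mem_Ico] at hn; omega)
        push_cast at this ⊢
        linarith)
    have h1 := norm_sum_unitExp_split_le φ hc1 hc2
    push_cast
    linarith

/-- Van der Corput's second derivative test, for a phase with second differences between `ν ^ 2`
and `Λ`. -/
lemma norm_sum_unitExp_le_of_second_diff {φ : ℕ → ℝ} {ν Λ : ℝ} (hν : 0 < ν) (hν1 : ν ≤ 1)
    {a b : ℕ}
    (hs : ∀ n ∈ Finset.Ico a b, ν ^ 2 ≤ (φ (n + 2) - φ (n + 1)) - (φ (n + 1) - φ n))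
    (hΛ : ∀ n ∈ Finset.Ico a b, (φ (n + 2) - φ (n + 1)) - (φ (n + 1) - φ n) ≤ Λ) :
    ‖∑ n ∈ Finset.Ico a b, unitExp (φ n)‖ ≤ ((Finset.Ico a b).card * Λ + 2) * (7 / ν) := by
  rcases le_or_gt b a with hab | hab
  · rw [Finset.Ico_eq_empty (by omega)]
    simp only [Finset.sum_empty, norm_zero, Finset.card_empty, Nat.cast_zero, zero_mul]
    positivity
  have hΛ0 : 0 ≤ Λ := by
    have h1 := hs a (Finset.mem_Ico.2 ⟨le_rfl, hab⟩)
    have h2 := hΛ a (Finset.mem_Ico.2 ⟨le_rfl, hab⟩)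
    nlinarith
  have hcard : ((Finset.Ico a b).card : ℝ) = b - a := by
    rw [Nat.card_Ico, Nat.cast_sub hab.le]
  rw [hcard]
  have hba : (0 : ℝ) < (b : ℝ) - a := by
    have : (a : ℝ) < b := by exact_mod_cast hab
    linarith
  have hba' : 0 ≤ ((b : ℝ) - a) * Λ := by positivity
  have hM := Nat.ceil_lt_add_one hba'
  have hM' := Nat.le_ceil (((b : ℝ) - a) * Λ)
  have h := norm_sum_unitExp_le_of_slope_range (φ := φ) hν hν1 (⌈((b : ℝ) - a) * Λ⌉₊ + 1)
    (a := a) (b := b) ⌊φ (a + 1) - φ a⌋ hs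
    (fun n hn => by
      rw [Finset.mem_Ico] at hn
      have := mul_le_sub_of_forall_le (s := fun n => φ (n + 1) - φ n) (μ := 0) hn.1
        (fun m hm => by
          rw [Finset.mem_Ico] at hm
          have := hs m (Finset.mem_Ico.2 (by omega))
          simp only [add_assoc, Nat.reduceAdd]
          nlinarith)
      have h2 := Int.floor_le (φ (a + 1) - φ a)
      simp only [mul_zero] at this
      linarith)
    (fun n hn => by
      rw [Finset.mem_Ico] at hn
      have := mul_le_sub_of_forall_le (s := fun n => -(φ (n + 1) - φ n)) (μ := -Λ) hn.1
        (fun m hm => by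
          rw [Finset.mem_Ico] at hm
          have := hΛ m (Finset.mem_Ico.2 (by omega))
          simp only [add_assoc, Nat.reduceAdd]
          linarith)
      have h2 := Int.lt_floor_add_one (φ (a + 1) - φ a)
      have h3 : (n : ℝ) ≤ b := by exact_mod_cast hn.2.le
      have h4 := mul_le_mul_of_nonneg_right h3 hΛ0
      simp only [mul_neg] at this
      push_cast
      linarith)
  refine h.trans (mul_le_mul_of_nonneg_right ?_ (by positivity))
  push_cast
  linarith

/-- An exponential sum bound for a phase with third differences at least `μ`: the range of the
second differences is cut dyadically, and the second derivative test is used away from `0`. -/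
lemma norm_sum_unitExp_le_of_third_diff_dyadic {φ : ℕ → ℝ} {τ μ : ℝ} (hτ : 0 < τ) (hμ : 0 < μ)
    (hμτ : μ ≤ τ ^ 2) (k : ℕ) : ∀ {a b : ℕ}, 2 ^ k * τ ≤ 2 →
    (∀ n ∈ Finset.Ico a b, μ ≤ ((φ (n + 3) - φ (n + 2)) - (φ (n + 2) - φ (n + 1))) -
      ((φ (n + 2) - φ (n + 1)) - (φ (n + 1) - φ n))) →
    (∀ n ∈ Finset.Ico a b, -(2 ^ k * τ) ^ 2 ≤ (φ (n + 2) - φ (n + 1)) - (φ (n + 1) - φ n)) →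
    (∀ n ∈ Finset.Ico a b, (φ (n + 2) - φ (n + 1)) - (φ (n + 1) - φ n) ≤ (2 ^ k * τ) ^ 2) →
    ‖∑ n ∈ Finset.Ico a b, unitExp (φ n)‖ ≤
      2 * τ ^ 2 / μ + 1 + 32 * ((2 ^ k * τ) ^ 3 / μ + (2 / τ - 2 / (2 ^ k * τ))) := by
  induction k with
  | zero =>
    intro a b _ hs hl hu
    refine (norm_sum_unitExp_le_card _ _).trans ?_
    simp only [pow_zero, one_mul] at *
    have h := card_Ico_le_of_gap (s := fun n => (φ (n + 2) - φ (n + 1)) - (φ (n + 1) - φ n))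
      hμ (by nlinarith) hs hl hu
    have h2 : 0 ≤ τ ^ 3 / μ := by positivity
    have e : (τ ^ 2 - -τ ^ 2) / μ = 2 * τ ^ 2 / μ := by ring
    rw [e] at h
    linarith
  | succ k ih =>
    intro a b hk hs hl hu
    set ν := 2 ^ k * τ with hνdef
    have hν : 0 < ν := by positivity
    have e0 : 2 ^ (k + 1) * τ = 2 * ν := by rw [hνdef]; ring
    rw [e0] at hk hl hu ⊢
    have hν1 : ν ≤ 1 := by linarith
    have hμν : μ ≤ ν ^ 2 := by
      refine hμτ.trans ?_
      have : τ ≤ ν := le_mul_of_one_le_left hτ.le (one_le_pow₀ (by norm_num))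
      gcongr
    set s : ℕ → ℝ := fun n => (φ (n + 2) - φ (n + 1)) - (φ (n + 1) - φ n) with hsdef
    rcases le_or_gt b a with hab | hab
    · rw [Finset.Ico_eq_empty (by omega)]
      simp only [Finset.sum_empty, norm_zero]
      have h1 : 2 / (2 * ν) ≤ 2 / τ := by
        have : τ ≤ ν := le_mul_of_one_le_left hτ.le (one_le_pow₀ (by norm_num))
        gcongr
        linarith
      have h2 : 0 ≤ 2 / τ - 2 / (2 * ν) := by linarith
      positivity
    simp only [Finset.mem_Ico] at hs hl hu
    have hsm : ∀ n, a ≤ n ∧ n < b → s n ≤ s (n + 1) := fun n hn => by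
      have := hs n hn
      simp only [hsdef, add_assoc, Nat.reduceAdd]
      linarith
    obtain ⟨c, hc1, hc2, hc3, hc4⟩ := exists_monotone_cut (s := s) hab.le
      (fun n hn => hsm n (by rw [Finset.mem_Ico] at hn; omega)) (-ν ^ 2)
    obtain ⟨d, hd1, hd2, hd3, hd4⟩ := exists_monotone_cut (s := s) hc2
      (fun n hn => hsm n (by rw [Finset.mem_Ico] at hn; omega)) (ν ^ 2)
    have hcount : (3 * ν ^ 2) / μ + 1 ≤ 4 * ν ^ 2 / μ := by
      have : 1 ≤ ν ^ 2 / μ := by rw [le_div_iff₀ hμ]; linarith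
      have e : 4 * ν ^ 2 / μ = 3 * ν ^ 2 / μ + ν ^ 2 / μ := by ring
      linarith
    have flank : ∀ x : ℝ, x ≤ 4 * ν ^ 2 / μ →
        (x * (2 * ν) ^ 2 + 2) * (7 / ν) ≤ 112 * (ν ^ 3 / μ) + 14 / ν := by
      intro x hx
      calc (x * (2 * ν) ^ 2 + 2) * (7 / ν) ≤ (4 * ν ^ 2 / μ * (2 * ν) ^ 2 + 2) * (7 / ν) := by
            gcongr
        _ = _ := by field_simp; ring
    have b1 : ‖∑ n ∈ Finset.Ico a c, unitExp (φ n)‖ ≤ 112 * (ν ^ 3 / μ) + 14 / ν := by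
      rw [← norm_sum_unitExp_neg]
      have hcard := card_Ico_le_of_gap (s := s) (a := a) (b := c) (u := -(2 * ν) ^ 2)
        (v := -ν ^ 2) hμ (by nlinarith) (fun n hn => hs n (by rw [Finset.mem_Ico] at hn; omega))
        (fun n hn => hl n (by rw [Finset.mem_Ico] at hn; omega)) (fun n hn => (hc3 n hn).le)
      have e : (-ν ^ 2 - -(2 * ν) ^ 2) / μ = (3 * ν ^ 2) / μ := by ring
      rw [e] at hcard
      refine (norm_sum_unitExp_le_of_second_diff (φ := fun n => -φ n) (Λ := (2 * ν) ^ 2) hν hν1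
        (fun n hn => ?_) (fun n hn => ?_)).trans (flank _ (hcard.trans hcount))
      · have := hc3 n hn
        simp only [hsdef] at this
        linarith
      · have := hl n (by rw [Finset.mem_Ico] at hn; omega)
        linarith
    have b3 : ‖∑ n ∈ Finset.Ico d b, unitExp (φ n)‖ ≤ 112 * (ν ^ 3 / μ) + 14 / ν := by
      have hcard := card_Ico_le_of_gap (s := s) (a := d) (b := b) (u := ν ^ 2)
        (v := (2 * ν) ^ 2) hμ (by nlinarith)
        (fun n hn => hs n (by rw [Finset.mem_Ico] at hn; omega))
        hd4 (fun n hn => hu n (by rw [Finset.mem_Ico] at hn; omega))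
      have e : ((2 * ν) ^ 2 - ν ^ 2) / μ = (3 * ν ^ 2) / μ := by ring
      rw [e] at hcard
      exact (norm_sum_unitExp_le_of_second_diff (Λ := (2 * ν) ^ 2) hν hν1 hd4
        (fun n hn => hu n (by rw [Finset.mem_Ico] at hn; omega))).trans
        (flank _ (hcard.trans hcount))
    have b2 := ih (a := c) (b := d) (by linarith)
      (fun n hn => hs n (by rw [Finset.mem_Ico] at hn; omega))
      (fun n hn => hc4 n (by rw [Finset.mem_Ico] at *; omega)) (fun n hn => (hd3 n hn).le)
    have h1 := norm_sum_unitExp_split_le φ hc1 hc2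
    have h2 := norm_sum_unitExp_split_le φ hd1 hd2
    have e1 : (2 * ν) ^ 3 / μ = 8 * (ν ^ 3 / μ) := by ring
    have e2 : 2 / (2 * ν) = 1 / ν := by field_simp
    have e3 : 2 / ν = 2 * (1 / ν) := by ring
    have e4 : 14 / ν = 14 * (1 / ν) := by ring
    have h5 : 0 < 1 / ν := by positivity
    have h6 : 0 ≤ ν ^ 3 / μ := by positivity
    rw [e1, e2]
    rw [e3] at b2
    rw [e4] at b1 b3
    linarith

/-- An exponential sum bound for a phase with second differences at most `σ ^ 2` in absolute value
and third differences at least `μ`. -/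
lemma norm_sum_unitExp_le_of_third_diff {φ : ℕ → ℝ} {τ σ μ : ℝ} (hτ : 0 < τ) (hμ : 0 < μ)
    (hμτ : μ ≤ τ ^ 2) (hτσ : τ ≤ σ) (hσ : σ ≤ 1) {a b : ℕ}
    (hs : ∀ n ∈ Finset.Ico a b, μ ≤ ((φ (n + 3) - φ (n + 2)) - (φ (n + 2) - φ (n + 1))) -
      ((φ (n + 2) - φ (n + 1)) - (φ (n + 1) - φ n)))
    (hl : ∀ n ∈ Finset.Ico a b, |(φ (n + 2) - φ (n + 1)) - (φ (n + 1) - φ n)| ≤ σ ^ 2) :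
    ‖∑ n ∈ Finset.Ico a b, unitExp (φ n)‖ ≤
      2 * τ ^ 2 / μ + 1 + 256 * (σ ^ 3 / μ) + 64 / τ := by
  obtain ⟨k, hk1, hk2⟩ := exists_nat_pow_near (x := σ / τ) (y := 2)
    (by rw [le_div_iff₀ hτ]; linarith) (by norm_num)
  rw [le_div_iff₀ hτ] at hk1
  rw [div_lt_iff₀ hτ] at hk2
  have hσ0 : 0 < σ := hτ.trans_le hτσ
  have hk3 : 2 ^ (k + 1) * τ ≤ 2 * σ := by rw [pow_succ]; linarith
  have hsq : σ ^ 2 ≤ (2 ^ (k + 1) * τ) ^ 2 := by gcongr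
  have h := norm_sum_unitExp_le_of_third_diff_dyadic hτ hμ hμτ (k + 1) (a := a) (b := b)
    (by linarith) hs (fun n hn => by linarith [(abs_le.1 (hl n hn)).1])
    (fun n hn => by linarith [(abs_le.1 (hl n hn)).2])
  have h3 : (2 ^ (k + 1) * τ) ^ 3 / μ ≤ (2 * σ) ^ 3 / μ := by gcongr
  have e : (2 * σ) ^ 3 / μ = 8 * (σ ^ 3 / μ) := by ring
  have e2 : 64 / τ = 32 * (2 / τ) := by ring
  have h4 : 0 ≤ 2 / (2 ^ (k + 1) * τ) := by positivity
  rw [e2]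
  linarith

lemma hasDerivWithinAt_forward_diff {F F' : ℝ → ℝ} {u v h : ℝ} (hh : 0 ≤ h)
    (hF : ∀ x ∈ Icc u v, HasDerivWithinAt F (F' x) (Icc u v) x) :
    ∀ x ∈ Icc u (v - h), HasDerivWithinAt (fun x => F (x + h) - F x) (F' (x + h) - F' x)
      (Icc u (v - h)) x := by
  intro x hx
  have h1 : HasDerivWithinAt (fun x => F (x + h)) (F' (x + h)) (Icc u (v - h)) x := by
    have h2 := HasDerivWithinAt.comp x (h := fun y => y + h)
      (hF (x + h) ⟨by linarith [hx.1], by linarith [hx.2]⟩)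
      (((hasDerivAt_id x).add_const h).hasDerivWithinAt (s := Icc u (v - h)))
      (fun y hy => ⟨by linarith [hy.1], by linarith [hy.2]⟩)
    simpa [Function.comp_def] using h2
  exact h1.sub ((hF x ⟨hx.1, by linarith [hx.2]⟩).mono (Icc_subset_Icc_right (by linarith)))

lemma mul_le_forward_diff {F F' : ℝ → ℝ} {u v h m : ℝ} (hh : 0 < h)
    (hF : ∀ x ∈ Icc u v, HasDerivWithinAt F (F' x) (Icc u v) x)
    (hm : ∀ x ∈ Icc u v, m ≤ F' x) {x : ℝ} (hx : x ∈ Icc u (v - h)) :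
    m * h ≤ F (x + h) - F x := by
  have hsub : Icc x (x + h) ⊆ Icc u v := Icc_subset_Icc hx.1 (by linarith [hx.2])
  obtain ⟨y, hy, hy2⟩ := exists_hasDerivAt_eq_slope F F' (a := x) (b := x + h) (by linarith)
    (fun y hy => ((hF y (hsub hy)).continuousWithinAt).mono hsub)
    (fun y hy => (hF y (hsub ⟨hy.1.le, hy.2.le⟩)).hasDerivAt
      (Icc_mem_nhds (by linarith [hx.1, hy.1]) (by linarith [hx.2, hy.2])))
  have := hm y (hsub ⟨hy.1.le, hy.2.le⟩)
  rw [add_sub_cancel_left, eq_div_iff hh.ne'] at hy2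
  rw [← hy2]
  gcongr

lemma mul_sq_le_second_diff {F F' F'' : ℝ → ℝ} {u v h m : ℝ} (hh : 0 < h)
    (hF : ∀ x ∈ Icc u v, HasDerivWithinAt F (F' x) (Icc u v) x)
    (hF' : ∀ x ∈ Icc u v, HasDerivWithinAt F' (F'' x) (Icc u v) x)
    (hm : ∀ x ∈ Icc u v, m ≤ F'' x) {x : ℝ} (hx : x ∈ Icc u (v - h - h)) :
    m * h ^ 2 ≤ (F (x + h + h) - F (x + h)) - (F (x + h) - F x) := by
  have h1 := mul_le_forward_diff hh (hasDerivWithinAt_forward_diff hh.le hF)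
    (fun x hx => mul_le_forward_diff hh hF' hm hx) hx
  linarith

lemma mul_cube_le_third_diff {F F' F'' F''' : ℝ → ℝ} {u v h m : ℝ} (hh : 0 < h)
    (hF : ∀ x ∈ Icc u v, HasDerivWithinAt F (F' x) (Icc u v) x)
    (hF' : ∀ x ∈ Icc u v, HasDerivWithinAt F' (F'' x) (Icc u v) x)
    (hF'' : ∀ x ∈ Icc u v, HasDerivWithinAt F'' (F''' x) (Icc u v) x)
    (hm : ∀ x ∈ Icc u v, m ≤ F''' x) {x : ℝ} (hx : x ∈ Icc u (v - h - h - h)) :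
    m * h ^ 3 ≤ ((F (x + h + h + h) - F (x + h + h)) - (F (x + h + h) - F (x + h))) -
      ((F (x + h + h) - F (x + h)) - (F (x + h) - F x)) := by
  have h1 := mul_sq_le_second_diff hh (hasDerivWithinAt_forward_diff hh.le hF)
    (hasDerivWithinAt_forward_diff hh.le hF')
    (fun x hx => mul_le_forward_diff hh hF'' hm hx) hx
  linarith

lemma div_le_second_diff_dilation {F F' F'' : ℝ → ℝ} {u v m : ℝ} {q : ℕ} (hq : 0 < q)
    (hF : ∀ x ∈ Icc u v, HasDerivWithinAt F (F' x) (Icc u v) x)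
    (hF' : ∀ x ∈ Icc u v, HasDerivWithinAt F' (F'' x) (Icc u v) x)
    (hm : ∀ x ∈ Icc u v, m ≤ F'' x) {n : ℕ} (hu : u * q ≤ n) (hv : (n : ℝ) + 2 ≤ v * q) :
    m / q ≤ (q * F ((n + 2 : ℕ) / q) - q * F ((n + 1 : ℕ) / q)) -
      (q * F ((n + 1 : ℕ) / q) - q * F (n / q)) := by
  have hq' : (0 : ℝ) < q := by exact_mod_cast hq
  have h := mul_sq_le_second_diff (h := 1 / (q : ℝ)) (by positivity) hF hF' hm (x := n / q)
    ⟨by rw [le_div_iff₀ hq']; exact hu, by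
      have : (n : ℝ) / q ≤ (v * q - 2) / q := by gcongr; linarith
      refine this.trans (le_of_eq ?_)
      field_simp
      ring⟩
  have e1 : (n : ℝ) / q + 1 / q = (n + 1 : ℕ) / q := by push_cast; ring
  have e2 : ((n + 1 : ℕ) : ℝ) / q + 1 / q = (n + 2 : ℕ) / q := by push_cast; ring
  rw [e1, e2] at h
  have h2 := mul_le_mul_of_nonneg_left h hq'.le
  have e : (q : ℝ) * (m * (1 / q) ^ 2) = m / q := by field_simp
  rw [e] at h2
  linarith

lemma div_sq_le_third_diff_dilation {F F' F'' F''' : ℝ → ℝ} {u v m : ℝ} {q : ℕ} (hq : 0 < q)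
    (hF : ∀ x ∈ Icc u v, HasDerivWithinAt F (F' x) (Icc u v) x)
    (hF' : ∀ x ∈ Icc u v, HasDerivWithinAt F' (F'' x) (Icc u v) x)
    (hF'' : ∀ x ∈ Icc u v, HasDerivWithinAt F'' (F''' x) (Icc u v) x)
    (hm : ∀ x ∈ Icc u v, m ≤ F''' x) {n : ℕ} (hu : u * q ≤ n) (hv : (n : ℝ) + 3 ≤ v * q) :
    m / q ^ 2 ≤ ((q * F ((n + 3 : ℕ) / q) - q * F ((n + 2 : ℕ) / q)) -
      (q * F ((n + 2 : ℕ) / q) - q * F ((n + 1 : ℕ) / q))) -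
      ((q * F ((n + 2 : ℕ) / q) - q * F ((n + 1 : ℕ) / q)) -
      (q * F ((n + 1 : ℕ) / q) - q * F (n / q))) := by
  have hq' : (0 : ℝ) < q := by exact_mod_cast hq
  have h := mul_cube_le_third_diff (h := 1 / (q : ℝ)) (by positivity) hF hF' hF'' hm (x := n / q)
    ⟨by rw [le_div_iff₀ hq']; exact hu, by
      have : (n : ℝ) / q ≤ (v * q - 3) / q := by gcongr; linarith
      refine this.trans (le_of_eq ?_)
      field_simp
      ring⟩
  have e1 : (n : ℝ) / q + 1 / q = (n + 1 : ℕ) / q := by push_cast; ring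
  have e2 : ((n + 1 : ℕ) : ℝ) / q + 1 / q = (n + 2 : ℕ) / q := by push_cast; ring
  have e3 : ((n + 2 : ℕ) : ℝ) / q + 1 / q = (n + 3 : ℕ) / q := by push_cast; ring
  rw [e1, e2, e3] at h
  have h2 := mul_le_mul_of_nonneg_left h hq'.le
  have e : (q : ℝ) * (m * (1 / q) ^ 3) = m / q ^ 2 := by field_simp
  rw [e] at h2
  linarith

/-- The exponential sum bound on an arc where either the second or the third derivative is at least
`c * r`, in terms of a parameter `T`. -/
lemma norm_sum_unitExp_arc_le {F F' F'' F''' : ℝ → ℝ} {u v c C r T : ℝ} {q a b : ℕ}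
    (hc : 0 < c) (hc1 : c ≤ 1) (hC : 1 ≤ C) (hr : 1 ≤ r) (hCr : C * r ≤ q)
    (hT1 : r * q ≤ T ^ 2) (hT2 : q ^ 2 ≤ r * T ^ 3) (hT3 : r * T ^ 2 ≤ q ^ 2)
    (hT : 1 ≤ T)
    (hF : ∀ x ∈ Icc u v, HasDerivWithinAt F (F' x) (Icc u v) x)
    (hF' : ∀ x ∈ Icc u v, HasDerivWithinAt F' (F'' x) (Icc u v) x)
    (hF'' : ∀ x ∈ Icc u v, HasDerivWithinAt F'' (F''' x) (Icc u v) x)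
    (hbd : ∀ x ∈ Icc u v, |F'' x| ≤ C * r)
    (hlow : (∀ x ∈ Icc u v, c * r ≤ F'' x) ∨ ∀ x ∈ Icc u v, c * r ≤ F''' x)
    (ha : u * q ≤ a) (hb : (b : ℝ) + 2 ≤ v * q) (hbq : b ≤ q) :
    ‖∑ n ∈ Finset.Ico a b, unitExp (q * F (n / q))‖ ≤
      (7 * (C + 2) / √c + (2 / c + 1 + 256 * (C * √C / c) + 64)) * T := by
  have hq : (0 : ℝ) < q := by nlinarith
  have hq0 : 0 < q := by exact_mod_cast hq
  have hT0 : 0 < T := by linarith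
  have hr0 : 0 < r := by linarith
  have hqT : (q : ℝ) ≤ T ^ 2 := by nlinarith
  have hn : ∀ n ∈ Finset.Ico a b, u * q ≤ n ∧ (n : ℝ) + 3 ≤ v * q := by
    intro n hn
    rw [Finset.mem_Ico] at hn
    have h1 : (a : ℝ) ≤ n := by exact_mod_cast hn.1
    have h2 : (n : ℝ) + 1 ≤ b := by exact_mod_cast hn.2
    constructor <;> linarith
  set φ : ℕ → ℝ := fun n => q * F (n / q) with hφ
  have hup : ∀ n ∈ Finset.Ico a b,
      |(φ (n + 2) - φ (n + 1)) - (φ (n + 1) - φ n)| ≤ C * r / q := by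
    intro n hn'
    have h1 := div_le_second_diff_dilation hq0 hF hF' (fun x hx => (abs_le.1 (hbd x hx)).1)
      (hn n hn').1 (by linarith [(hn n hn').2])
    have h2 := div_le_second_diff_dilation hq0 (fun x hx => (hF x hx).neg)
      (fun x hx => (hF' x hx).neg) (m := -(C * r))
      (fun x hx => by simpa using (abs_le.1 (hbd x hx)).2)
      (hn n hn').1 (by linarith [(hn n hn').2])
    simp only [Pi.neg_apply] at h2
    rw [neg_div] at h1 h2
    rw [abs_le]
    simp only [hφ]
    constructor <;> linarith
  have hA : 0 ≤ 7 * (C + 2) / √c * T := by positivity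
  have hB : 0 ≤ (2 / c + 1 + 256 * (C * √C / c) + 64) * T := by positivity
  rw [add_mul]
  rcases hlow with hlow | hlow
  · set ν := √(c * r / q) with hν
    have hν0 : 0 < ν := by positivity
    have hν2 : ν ^ 2 = c * r / q := sq_sqrt (by positivity)
    have hν1 : ν ≤ 1 := by
      refine sqrt_le_iff.2 ⟨zero_le_one, ?_⟩
      rw [one_pow, div_le_one hq]
      nlinarith
    have h := norm_sum_unitExp_le_of_second_diff (φ := φ) hν0 hν1 (a := a) (b := b)
      (fun n hn' => by
        rw [hν2]
        exact div_le_second_diff_dilation hq0 hF hF' hlow (hn n hn').1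
          (by linarith [(hn n hn').2])) (fun n hn' => (le_abs_self _).trans (hup n hn'))
    have hcard : ((Finset.Ico a b).card : ℝ) ≤ q := by
      rw [Nat.card_Ico]
      exact_mod_cast (by omega)
    have h1 : (Finset.Ico a b).card * (C * r / q) + 2 ≤ (C + 2) * r := by
      have : (Finset.Ico a b).card * (C * r / q) ≤ q * (C * r / q) := by gcongr
      rw [mul_div_cancel₀ _ hq.ne'] at this
      linarith
    have h2 : r * √c ≤ ν * T := by
      refine abs_le_of_sq_le_sq' ?_ (by positivity) |>.2
      rw [mul_pow, mul_pow, sq_sqrt hc.le, hν2, div_mul_eq_mul_div, le_div_iff₀ hq]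
      have := mul_le_mul_of_nonneg_left hT1 (by positivity : 0 ≤ c * r)
      linarith
    have h3 : r * (7 / ν) ≤ 7 / √c * T := by
      rw [← mul_div_assoc, div_mul_eq_mul_div, div_le_div_iff₀ hν0 (by positivity)]
      linarith
    calc _ ≤ (C + 2) * r * (7 / ν) := h.trans (by gcongr)
      _ ≤ (C + 2) * (7 / √c * T) := by
        rw [mul_assoc]
        gcongr
      _ = 7 * (C + 2) / √c * T := by ring
      _ ≤ _ := by linarith
  · set σ := √(C * r / q) with hσ
    have hσ0 : 0 < σ := by positivity
    have hσ2 : σ ^ 2 = C * r / q := sq_sqrt (by positivity)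
    have hσ1 : σ ≤ 1 := by
      refine sqrt_le_iff.2 ⟨zero_le_one, ?_⟩
      rwa [one_pow, div_le_one hq]
    have hσT : σ * q ≤ √C * T := by
      refine abs_le_of_sq_le_sq' ?_ (by positivity) |>.2
      rw [mul_pow, mul_pow, hσ2, sq_sqrt (by linarith)]
      have e : C * r / q * (q : ℝ) ^ 2 = C * (r * q) := by field_simp
      rw [e]
      gcongr
    have hμT : c * r / q ^ 2 ≤ (1 / T) ^ 2 := by
      rw [div_pow, one_pow, div_le_div_iff₀ (by positivity) (by positivity)]
      nlinarith [mul_le_mul_of_nonneg_right hc1 (by positivity : 0 ≤ r * T ^ 2)]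
    have hTσ : 1 / T ≤ σ := by
      rw [div_le_iff₀ hT0]
      have : 1 ^ 2 ≤ (σ * T) ^ 2 := by
        rw [mul_pow, hσ2, div_mul_eq_mul_div, le_div_iff₀ hq]
        have : 1 ≤ C * r := by nlinarith
        nlinarith
      exact abs_le_of_sq_le_sq' this (by positivity) |>.2
    have h := norm_sum_unitExp_le_of_third_diff (φ := φ) (τ := 1 / T) (σ := σ)
      (μ := c * r / q ^ 2) (by positivity) (by positivity) hμT hTσ hσ1 (a := a) (b := b)
      (fun n hn' => div_sq_le_third_diff_dilation hq0 hF hF' hF'' hlow (hn n hn').1 (hn n hn').2)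
      (fun n hn' => by
        rw [hσ2]
        exact hup n hn')
    have h1 : 2 * (1 / T) ^ 2 / (c * r / q ^ 2) ≤ 2 / c * T := by
      have e : 2 * (1 / T) ^ 2 / (c * r / q ^ 2) = 2 / c * (q ^ 2 / (r * T ^ 2)) := by
        field_simp
      rw [e]
      gcongr
      rw [div_le_iff₀ (by positivity)]
      linarith
    have h2 : σ ^ 3 / (c * r / q ^ 2) ≤ C * √C / c * T := by
      have e : σ ^ 3 / (c * r / q ^ 2) = C / c * (σ * q) := by
        rw [pow_succ, hσ2]
        field_simp
      rw [e]
      calc C / c * (σ * q) ≤ C / c * (√C * T) := by gcongr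
        _ = _ := by ring
    have e : 64 / (1 / T) = 64 * T := by field_simp
    rw [e] at h
    linarith

/-- Uniform nondegeneracy of the linear combinations of the components of a space curve with
nonvanishing torsion. -/
lemma exists_partition_of_wronskian_ne_zero {g₁ h₁ g₂ h₂ : ℝ → ℝ}
    (hg₁ : ContinuousOn g₁ (Icc 0 1)) (hh₁ : ContinuousOn h₁ (Icc 0 1))
    (hg₂ : ContinuousOn g₂ (Icc 0 1)) (hh₂ : ContinuousOn h₂ (Icc 0 1))
    (hW : ∀ x ∈ Icc (0 : ℝ) 1, g₁ x * h₂ x - g₂ x * h₁ x ≠ 0) :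
    ∃ (c C : ℝ) (L : ℕ), 0 < c ∧ c ≤ 1 ∧ 1 ≤ C ∧ 0 < L ∧ ∀ j k r : ℝ, |j| ≤ r → |k| ≤ r →
      (|j| = r ∨ |k| = r) → (∀ x ∈ Icc (0 : ℝ) 1, |j * g₁ x + k * g₂ x| ≤ C * r) ∧
      ∀ m < L,
        ((∀ x ∈ Icc (m / L : ℝ) ((m + 1 : ℕ) / L), c * r ≤ j * g₁ x + k * g₂ x) ∨
        (∀ x ∈ Icc (m / L : ℝ) ((m + 1 : ℕ) / L), c * r ≤ j * h₁ x + k * h₂ x)) ∨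
        ((∀ x ∈ Icc (m / L : ℝ) ((m + 1 : ℕ) / L), c * r ≤ -j * g₁ x + -k * g₂ x) ∨
        (∀ x ∈ Icc (m / L : ℝ) ((m + 1 : ℕ) / L), c * r ≤ -j * h₁ x + -k * h₂ x)) := by
  have hG : ContinuousOn (fun x => ((g₁ x, h₁ x), (g₂ x, h₂ x))) (Icc 0 1) :=
    (hg₁.prodMk hh₁).prodMk (hg₂.prodMk hh₂)
  obtain ⟨B₀, hB₀⟩ := isCompact_Icc.exists_bound_of_continuousOn hG
  obtain ⟨B, hB1, hB⟩ : ∃ B : ℝ, 1 ≤ B ∧ ∀ x ∈ Icc (0 : ℝ) 1,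
      |g₁ x| ≤ B ∧ |h₁ x| ≤ B ∧ |g₂ x| ≤ B ∧ |h₂ x| ≤ B := by
    refine ⟨max B₀ 1, le_max_right _ _, fun x hx => ?_⟩
    have h := (hB₀ x hx).trans (le_max_left B₀ 1)
    simp only [Prod.norm_def, max_le_iff, Real.norm_eq_abs] at h
    exact ⟨h.1.1, h.1.2, h.2.1, h.2.2⟩
  have hWc : ContinuousOn (fun x => |g₁ x * h₂ x - g₂ x * h₁ x|) (Icc 0 1) :=
    ((hg₁.mul hh₂).sub (hg₂.mul hh₁)).abs
  obtain ⟨x₀, hx₀, hmin⟩ := isCompact_Icc.exists_isMinOn (nonempty_Icc.2 zero_le_one) hWc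
  set w := |g₁ x₀ * h₂ x₀ - g₂ x₀ * h₁ x₀| with hw
  have hw0 : 0 < w := abs_pos.2 (hW x₀ hx₀)
  have hwle : ∀ x ∈ Icc (0 : ℝ) 1, w ≤ |g₁ x * h₂ x - g₂ x * h₁ x| := fun x hx => hmin hx
  have hc : 0 < min 1 (w / (4 * B)) := by positivity
  set c := min 1 (w / (4 * B)) with hcdef
  have hcw : c * (4 * B) ≤ w := by
    rw [← le_div_iff₀ (by positivity)]
    exact min_le_right _ _
  obtain ⟨η, hη, hunif⟩ := Metric.uniformContinuousOn_iff.1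
    (isCompact_Icc.uniformContinuousOn_of_continuous hG) (c / 2) (by positivity)
  obtain ⟨N, hN⟩ := exists_nat_one_div_lt hη
  refine ⟨c, 2 * B, N + 1, hc, min_le_left _ _, by linarith, by omega, ?_⟩
  intro j k r hj hk hjk
  have hr : 0 ≤ r := (abs_nonneg j).trans hj
  have hcomb : ∀ s t y : ℝ, |s| ≤ y → |t| ≤ y → |j * s + k * t| ≤ 2 * y * r := by
    intro s t y hs ht
    refine (abs_add_le _ _).trans ?_
    rw [abs_mul, abs_mul]
    have h1 : |j| * |s| ≤ r * y := by gcongr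
    have h2 : |k| * |t| ≤ r * y := by gcongr
    linarith
  refine ⟨fun x hx => hcomb _ _ _ (hB x hx).1 (hB x hx).2.2.1, fun m hm => ?_⟩
  have hL : (0 : ℝ) < (N + 1 : ℕ) := by positivity
  have hsub : Icc ((m : ℝ) / (N + 1 : ℕ)) ((m + 1 : ℕ) / (N + 1 : ℕ)) ⊆ Icc 0 1 := by
    refine Icc_subset_Icc (by positivity) ?_
    rw [div_le_one hL]
    exact_mod_cast hm
  set x := (m : ℝ) / (N + 1 : ℕ) with hx
  have hx1 : x ≤ (m + 1 : ℕ) / (N + 1 : ℕ) := by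
    rw [hx]
    gcongr
    omega
  have hxI : x ∈ Icc (0 : ℝ) 1 := hsub ⟨le_rfl, hx1⟩
  have hclose : ∀ y ∈ Icc x ((m + 1 : ℕ) / (N + 1 : ℕ)),
      |(j * g₁ y + k * g₂ y) - (j * g₁ x + k * g₂ x)| ≤ c * r ∧
      |(j * h₁ y + k * h₂ y) - (j * h₁ x + k * h₂ x)| ≤ c * r := by
    intro y hy
    have hd : dist y x < η := by
      rw [Real.dist_eq, abs_of_nonneg (by linarith [hy.1])]
      have e : ((m + 1 : ℕ) : ℝ) / (N + 1 : ℕ) = x + 1 / ((N : ℝ) + 1) := by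
        rw [hx]
        push_cast
        ring
      have := hy.2
      linarith
    have h := (hunif y (hsub hy) x hxI hd).le
    simp only [Prod.dist_eq, Real.dist_eq, max_le_iff] at h
    constructor
    · have := hcomb _ _ _ h.1.1 h.2.1
      rw [show j * g₁ y + k * g₂ y - (j * g₁ x + k * g₂ x) =
        j * (g₁ y - g₁ x) + k * (g₂ y - g₂ x) by ring]
      linarith
    · have := hcomb _ _ _ h.1.2 h.2.2
      rw [show j * h₁ y + k * h₂ y - (j * h₁ x + k * h₂ x) =
        j * (h₁ y - h₁ x) + k * (h₂ y - h₂ x) by ring]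
      linarith
  set G := j * g₁ x + k * g₂ x with hGdef
  set H := j * h₁ x + k * h₂ x with hHdef
  obtain ⟨b1, b2, b3, b4⟩ := hB x hxI
  have hsum : r * w ≤ B * (|G| + |H|) := by
    have hlin : ∀ s t : ℝ, |s| ≤ B → |t| ≤ B → |G * s - H * t| ≤ B * (|G| + |H|) := by
      intro s t hs ht
      refine (abs_sub _ _).trans ?_
      rw [abs_mul, abs_mul]
      have h1 : |G| * |s| ≤ |G| * B := by gcongr
      have h2 : |H| * |t| ≤ |H| * B := by gcongr
      linarith
    have h0 : r * w ≤ r * |g₁ x * h₂ x - g₂ x * h₁ x| := by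
      gcongr
      exact hwle x hxI
    refine h0.trans ?_
    rcases hjk with h | h
    · rw [← h, ← abs_mul]
      have e : j * (g₁ x * h₂ x - g₂ x * h₁ x) = G * h₂ x - H * g₂ x := by
        rw [hGdef, hHdef]
        ring
      rw [e]
      exact hlin _ _ b4 b3
    · rw [← h, ← abs_mul]
      have e : k * (g₁ x * h₂ x - g₂ x * h₁ x) = -(G * h₁ x - H * g₁ x) := by
        rw [hGdef, hHdef]
        ring
      rw [e, abs_neg]
      exact hlin _ _ b2 b1
  have hGH : 4 * (c * r) ≤ |G| + |H| := by
    have h1 : r * (c * (4 * B)) ≤ B * (|G| + |H|) :=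
      (mul_le_mul_of_nonneg_left hcw hr).trans hsum
    have h2 : B * (4 * (c * r)) ≤ B * (|G| + |H|) := by linarith
    exact le_of_mul_le_mul_left h2 (by linarith)
  rcases le_total (2 * (c * r)) |G| with h | h
  · rcases le_abs.1 h with h | h
    · refine Or.inl (Or.inl fun y hy => ?_)
      linarith [(abs_le.1 (hclose y hy).1).1]
    · refine Or.inr (Or.inl fun y hy => ?_)
      linarith [(abs_le.1 (hclose y hy).1).2]
  · have h : 2 * (c * r) ≤ |H| := by linarith
    rcases le_abs.1 h with h | h
    · refine Or.inl (Or.inr fun y hy => ?_)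
      linarith [(abs_le.1 (hclose y hy).2).1]
    · refine Or.inr (Or.inr fun y hy => ?_)
      linarith [(abs_le.1 (hclose y hy).2).2]

lemma norm_sum_unitExp_le_add_three (φ : ℕ → ℝ) (a b : ℕ) :
    ‖∑ n ∈ Finset.Ico a b, unitExp (φ n)‖ ≤ ‖∑ n ∈ Finset.Ico a (b - 3), unitExp (φ n)‖ + 3 := by
  rcases le_or_gt a (b - 3) with h | h
  · refine (norm_sum_unitExp_split_le φ h (by omega)).trans ?_
    gcongr
    refine (norm_sum_unitExp_le_card _ _).trans ?_
    rw [Nat.card_Ico]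
    exact_mod_cast (by omega)
  · refine (norm_sum_unitExp_le_card _ _).trans ?_
    have : ((Finset.Ico a b).card : ℝ) ≤ 3 := by
      rw [Nat.card_Ico]
      exact_mod_cast (by omega)
    linarith [norm_nonneg (∑ n ∈ Finset.Ico a (b - 3), unitExp (φ n))]

lemma norm_sum_unitExp_range_le_of_partition (φ : ℕ → ℝ) {B : ℝ} {q L : ℕ} (hL : 0 < L)
    (hB : ∀ m < L, ‖∑ n ∈ Finset.Ico ⌈(m * q / L : ℝ)⌉₊ ⌈((m + 1 : ℕ) * q / L : ℝ)⌉₊,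
      unitExp (φ n)‖ ≤ B) :
    ‖∑ n ∈ Finset.range q, unitExp (φ n)‖ ≤ L * B := by
  have key : ∀ m ≤ L, ‖∑ n ∈ Finset.Ico 0 ⌈(m * q / L : ℝ)⌉₊, unitExp (φ n)‖ ≤ m * B := by
    intro m
    induction m with
    | zero => simp
    | succ m ih =>
      intro hm
      have hle : ⌈(m * q / L : ℝ)⌉₊ ≤ ⌈((m + 1 : ℕ) * q / L : ℝ)⌉₊ := by
        apply Nat.ceil_mono
        gcongr
        omega
      refine (norm_sum_unitExp_split_le φ (Nat.zero_le _) hle).trans ?_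
      push_cast [add_mul, one_mul]
      have h1 := ih (by omega)
      have h2 := hB m hm
      push_cast [add_mul, one_mul] at h2
      linarith
  have h := key L le_rfl
  have e : (L * q / L : ℝ) = q := by
    have : (L : ℝ) ≠ 0 := by positivity
    field_simp
  rwa [e, Nat.ceil_natCast, ← Finset.range_eq_Ico] at h

lemma exists_norm_sum_unitExp_curve_le
    {f₁ f₁' f₁'' f₁''' f₂ f₂' f₂'' f₂''' : ℝ → ℝ}
    (hf₁ : ∀ x ∈ Icc (0:ℝ) 1, HasDerivWithinAt f₁ (f₁' x) (Icc (0:ℝ) 1) x)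
    (hf₁' : ∀ x ∈ Icc (0:ℝ) 1, HasDerivWithinAt f₁' (f₁'' x) (Icc (0:ℝ) 1) x)
    (hf₁'' : ∀ x ∈ Icc (0:ℝ) 1, HasDerivWithinAt f₁'' (f₁''' x) (Icc (0:ℝ) 1) x)
    (hf₁''' : ContinuousOn f₁''' (Icc (0:ℝ) 1))
    (hf₂ : ∀ x ∈ Icc (0:ℝ) 1, HasDerivWithinAt f₂ (f₂' x) (Icc (0:ℝ) 1) x)
    (hf₂' : ∀ x ∈ Icc (0:ℝ) 1, HasDerivWithinAt f₂' (f₂'' x) (Icc (0:ℝ) 1) x)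
    (hf₂'' : ∀ x ∈ Icc (0:ℝ) 1, HasDerivWithinAt f₂'' (f₂''' x) (Icc (0:ℝ) 1) x)
    (hf₂''' : ContinuousOn f₂''' (Icc (0:ℝ) 1))
    (htor : ∀ x ∈ Icc (0:ℝ) 1, f₁'' x * f₂''' x - f₂'' x * f₁''' x ≠ 0) :
    ∃ K C : ℝ, 0 < K ∧ 1 ≤ C ∧ ∀ (j k r T : ℝ) (q : ℕ), |j| ≤ r → |k| ≤ r →
      (|j| = r ∨ |k| = r) → 1 ≤ r → C * r ≤ q → r * q ≤ T ^ 2 → (q : ℝ) ^ 2 ≤ r * T ^ 3 →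
      r * T ^ 2 ≤ (q : ℝ) ^ 2 → 1 ≤ T →
      ‖∑ n ∈ Finset.range (q + 1), unitExp (q * (j * f₁ (n / q) + k * f₂ (n / q)))‖ ≤ K * T := by
  obtain ⟨c, C, L, hc, hc1, hC, hL, hpart⟩ := exists_partition_of_wronskian_ne_zero
    (fun x hx => (hf₁'' x hx).continuousWithinAt) hf₁'''
    (fun x hx => (hf₂'' x hx).continuousWithinAt) hf₂''' htor
  set K₀ := 7 * (C + 2) / √c + (2 / c + 1 + 256 * (C * √C / c) + 64) with hK₀
  have hK₀0 : 0 < K₀ := by positivity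
  refine ⟨L * (K₀ + 3) + 1, C, by positivity, hC, ?_⟩
  intro j k r T q hj hk hjk hr hCr hT1 hT2 hT3 hT
  have hq : (0 : ℝ) < q := by nlinarith
  have hL' : (0 : ℝ) < L := by exact_mod_cast hL
  obtain ⟨hbd, hlow⟩ := hpart j k r hj hk hjk
  have hblock : ∀ m < L, ‖∑ n ∈ Finset.Ico ⌈(m * q / L : ℝ)⌉₊ ⌈((m + 1 : ℕ) * q / L : ℝ)⌉₊,
      unitExp (q * (j * f₁ (n / q) + k * f₂ (n / q)))‖ ≤ (K₀ + 3) * T := by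
    intro m hm
    refine (norm_sum_unitExp_le_add_three _ _ _).trans ?_
    rw [add_mul]
    refine add_le_add ?_ (by linarith)
    set a := ⌈(m * q / L : ℝ)⌉₊ with ha
    set b := ⌈((m + 1 : ℕ) * q / L : ℝ)⌉₊ with hb
    rcases le_or_gt (b - 3) a with hab | hab
    · rw [Finset.Ico_eq_empty (by omega)]
      simp only [Finset.sum_empty, norm_zero]
      positivity
    have hau : (m / L : ℝ) * q ≤ a := by
      rw [div_mul_eq_mul_div]
      exact Nat.le_ceil _
    have hbv : ((b - 3 : ℕ) : ℝ) + 2 ≤ ((m + 1 : ℕ) / L : ℝ) * q := by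
      have := Nat.ceil_lt_add_one (a := ((m + 1 : ℕ) * q / L : ℝ)) (by positivity)
      rw [← hb] at this
      rw [Nat.cast_sub (by omega), div_mul_eq_mul_div]
      push_cast at this ⊢
      linarith
    have hsub : Icc (m / L : ℝ) ((m + 1 : ℕ) / L) ⊆ Icc 0 1 := by
      refine Icc_subset_Icc (by positivity) ?_
      rw [div_le_one hL']
      exact_mod_cast hm
    have hbq : b - 3 ≤ q := by
      have h1 : ((m + 1 : ℕ) / L : ℝ) * q ≤ 1 * q := by
        gcongr
        rw [div_le_one hL']
        exact_mod_cast hm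
      have : ((b - 3 : ℕ) : ℝ) ≤ q := by linarith
      exact_mod_cast this
    have hder : ∀ {g₁ g₁' g₂ g₂' : ℝ → ℝ} (s t : ℝ),
        (∀ x ∈ Icc (0:ℝ) 1, HasDerivWithinAt g₁ (g₁' x) (Icc (0:ℝ) 1) x) →
        (∀ x ∈ Icc (0:ℝ) 1, HasDerivWithinAt g₂ (g₂' x) (Icc (0:ℝ) 1) x) →
        ∀ x ∈ Icc (m / L : ℝ) ((m + 1 : ℕ) / L),
          HasDerivWithinAt (fun x => s * g₁ x + t * g₂ x) (s * g₁' x + t * g₂' x)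
            (Icc (m / L : ℝ) ((m + 1 : ℕ) / L)) x := fun s t h1 h2 x hx =>
      (((h1 x (hsub hx)).const_mul s).add ((h2 x (hsub hx)).const_mul t)).mono hsub
    have harc : ∀ s t : ℝ,
        (∀ x ∈ Icc (m / L : ℝ) ((m + 1 : ℕ) / L), |s * f₁'' x + t * f₂'' x| ≤ C * r) →
        ((∀ x ∈ Icc (m / L : ℝ) ((m + 1 : ℕ) / L), c * r ≤ s * f₁'' x + t * f₂'' x) ∨
          ∀ x ∈ Icc (m / L : ℝ) ((m + 1 : ℕ) / L), c * r ≤ s * f₁''' x + t * f₂''' x) →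
        ‖∑ n ∈ Finset.Ico a (b - 3), unitExp (q * (s * f₁ (n / q) + t * f₂ (n / q)))‖ ≤
          K₀ * T := fun s t h1 h2 =>
      norm_sum_unitExp_arc_le (F := fun x => s * f₁ x + t * f₂ x)
        (F' := fun x => s * f₁' x + t * f₂' x) (F'' := fun x => s * f₁'' x + t * f₂'' x)
        (F''' := fun x => s * f₁''' x + t * f₂''' x)
        hc hc1 hC hr hCr hT1 hT2 hT3 hT (hder s t hf₁ hf₂)
        (hder s t hf₁' hf₂') (hder s t hf₁'' hf₂'') h1 h2 hau hbv hbq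
    rcases hlow m hm with h | h
    · exact harc j k (fun x hx => hbd x (hsub hx)) h
    · have h' := harc (-j) (-k) (fun x hx => by
        have e : -j * f₁'' x + -k * f₂'' x = -(j * f₁'' x + k * f₂'' x) := by ring
        rw [e, abs_neg]
        exact hbd x (hsub hx)) h
      have e : ∀ n : ℕ, (q : ℝ) * (-j * f₁ (n / q) + -k * f₂ (n / q)) =
          -(q * (j * f₁ (n / q) + k * f₂ (n / q))) := fun n => by ring
      simp_rw [e] at h'
      rwa [norm_sum_unitExp_neg] at h'
  have h := norm_sum_unitExp_range_le_of_partition _ hL hblock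
  rw [Finset.sum_range_succ]
  refine (norm_add_le _ _).trans ?_
  rw [norm_unitExp]
  have e : ((L : ℝ) * (K₀ + 3) + 1) * T = L * ((K₀ + 3) * T) + T := by ring
  rw [e]
  exact add_le_add h hT

lemma half_le_norm_sum_unitExp {J : ℕ} {y : ℝ} (m : ℤ) (hJ : 0 < J)
    (hy : |y - m| ≤ 1 / (6 * J)) : J / 2 ≤ ‖∑ j ∈ Finset.range J, unitExp (j * y)‖ := by
  have hJ' : (0 : ℝ) < J := by exact_mod_cast hJ
  refine le_trans ?_ (Complex.re_le_norm _)
  rw [Complex.re_sum]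
  have h : ∀ j ∈ Finset.range J, (1 / 2 : ℝ) ≤ (unitExp (j * y)).re := by
    intro j hj
    have hjJ : (j : ℝ) ≤ J := by exact_mod_cast (Finset.mem_range.1 hj).le
    rw [← unitExp_sub_intCast (j * y) (j * m), unitExp_re, ← cos_pi_div_three,
      ← cos_abs (2 * π * (j * y - (j * m : ℤ)))]
    have hπ := pi_pos
    have e : 2 * π * (j * y - (j * m : ℤ)) = 2 * π * (j * (y - m)) := by
      push_cast
      ring
    have h1 : |2 * π * (j * y - (j * m : ℤ))| ≤ π / 3 := by
      rw [e, abs_mul (2 * π), abs_of_pos (by positivity : 0 < 2 * π), abs_mul, Nat.abs_cast]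
      calc 2 * π * (j * |y - m|) ≤ 2 * π * (J * (1 / (6 * J))) := by gcongr
        _ = π / 3 := by field_simp; norm_num
    exact cos_le_cos_of_nonneg_of_le_pi (abs_nonneg _) (by linarith) h1
  have := Finset.card_nsmul_le_sum _ _ _ h
  rw [Finset.card_range, nsmul_eq_mul] at this
  linarith

lemma sum_norm_sq_sum_unitExp_le {ι κ : Type*} (s : Finset ι) (P : Finset κ) (ψ : κ → ι → ℝ) :
    ∑ n ∈ s, ‖∑ p ∈ P, unitExp (ψ p n)‖ ^ 2 ≤
      ∑ p ∈ P, ∑ p' ∈ P, ‖∑ n ∈ s, unitExp (ψ p n - ψ p' n)‖ := by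
  have h : ((∑ n ∈ s, ‖∑ p ∈ P, unitExp (ψ p n)‖ ^ 2 : ℝ) : ℂ) =
      ∑ p ∈ P, ∑ p' ∈ P, ∑ n ∈ s, unitExp (ψ p n - ψ p' n) := by
    push_cast
    simp_rw [← Complex.mul_conj', map_sum, ← unitExp_neg, Finset.sum_mul_sum, ← unitExp_add,
      ← sub_eq_add_neg]
    rw [Finset.sum_comm]
    refine Finset.sum_congr rfl fun p _ => Finset.sum_comm
  have h0 : 0 ≤ ∑ n ∈ s, ‖∑ p ∈ P, unitExp (ψ p n)‖ ^ 2 := by positivity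
  rw [← abs_of_nonneg h0, ← Real.norm_eq_abs, ← Complex.norm_real, h]
  exact (norm_sum_le _ _).trans (Finset.sum_le_sum fun p _ => norm_sum_le _ _)

/-- Detecting simultaneous closeness to the integers by exponential sums. -/
lemma card_mul_le_sum_norm_sum_unitExp {ι : Type*} (s t : Finset ι) (hts : t ⊆ s) (x y : ι → ℝ)
    {J : ℕ} (hJ : 0 < J) (hx : ∀ n ∈ t, ∃ m : ℤ, |x n - m| ≤ 1 / (6 * J))
    (hy : ∀ n ∈ t, ∃ m : ℤ, |y n - m| ≤ 1 / (6 * J)) :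
    t.card * ((J : ℝ) / 2) ^ 4 ≤
      ∑ p ∈ Finset.range J ×ˢ Finset.range J, ∑ p' ∈ Finset.range J ×ˢ Finset.range J,
        ‖∑ n ∈ s, unitExp (((p.1 : ℝ) - p'.1) * x n + ((p.2 : ℝ) - p'.2) * y n)‖ := by
  have h1 := sum_norm_sq_sum_unitExp_le s (Finset.range J ×ˢ Finset.range J)
    (fun p n => p.1 * x n + p.2 * y n)
  have h2 : t.card * ((J : ℝ) / 2) ^ 4 ≤
      ∑ n ∈ t, ‖∑ p ∈ Finset.range J ×ˢ Finset.range J, unitExp (p.1 * x n + p.2 * y n)‖ ^ 2 := by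
    rw [← nsmul_eq_mul]
    refine Finset.card_nsmul_le_sum _ _ _ fun n hn => ?_
    obtain ⟨m, hm⟩ := hx n hn
    obtain ⟨m', hm'⟩ := hy n hn
    have e : ∑ p ∈ Finset.range J ×ˢ Finset.range J, unitExp (p.1 * x n + p.2 * y n) =
        (∑ j ∈ Finset.range J, unitExp (j * x n)) * ∑ k ∈ Finset.range J, unitExp (k * y n) := by
      rw [Finset.sum_mul_sum, Finset.sum_product]
      simp_rw [unitExp_add]
    have h3 := half_le_norm_sum_unitExp m hJ hm
    have h4 := half_le_norm_sum_unitExp m' hJ hm'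
    rw [e, norm_mul]
    calc ((J : ℝ) / 2) ^ 4 = (J / 2 * (J / 2)) ^ 2 := by ring
      _ ≤ _ := by gcongr
  have h3 : ∑ n ∈ t, ‖∑ p ∈ Finset.range J ×ˢ Finset.range J,
        unitExp (p.1 * x n + p.2 * y n)‖ ^ 2 ≤
      ∑ n ∈ s, ‖∑ p ∈ Finset.range J ×ˢ Finset.range J, unitExp (p.1 * x n + p.2 * y n)‖ ^ 2 :=
    Finset.sum_le_sum_of_subset_of_nonneg hts fun _ _ _ => by positivity
  refine (h2.trans h3).trans (h1.trans (le_of_eq ?_))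
  refine Finset.sum_congr rfl fun p _ => Finset.sum_congr rfl fun p' _ => ?_
  congr 1
  refine Finset.sum_congr rfl fun n _ => ?_
  congr 1
  ring

lemma sum_range_inv_sqrt_succ_le (m : ℕ) :
    ∑ i ∈ Finset.range m, 1 / √((i : ℝ) + 1) ≤ 2 * √m := by
  induction m with
  | zero => simp
  | succ m ih =>
    rw [Finset.sum_range_succ]
    push_cast
    have h0 : 0 < √((m : ℝ) + 1) := by positivity
    have h1 : √((m : ℝ) + 1) ^ 2 = m + 1 := sq_sqrt (by positivity)
    have h2 : √(m : ℝ) ^ 2 = m := sq_sqrt (by positivity)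
    have h3 : 1 / √((m : ℝ) + 1) ≤ 2 * √((m : ℝ) + 1) - 2 * √m := by
      rw [div_le_iff₀ h0]
      nlinarith [sq_nonneg (√((m : ℝ) + 1) - √m)]
    linarith

lemma sum_range_inv_sqrt_abs_sub_le {j J : ℕ} (hj : j < J) :
    ∑ i ∈ Finset.range J, 1 / √|(j : ℝ) - i| ≤ 4 * √J := by
  have h1 : ∑ i ∈ Finset.range j, 1 / √|(j : ℝ) - i| ≤ 2 * √J := by
    have e : ∑ i ∈ Finset.range j, 1 / √|(j : ℝ) - i| =
        ∑ i ∈ Finset.range j, 1 / √((i : ℝ) + 1) := by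
      rw [← Finset.sum_range_reflect]
      refine Finset.sum_congr rfl fun i hi => ?_
      rw [Finset.mem_range] at hi
      congr 2
      rw [Nat.cast_sub (by omega), Nat.cast_sub (by omega)]
      push_cast
      rw [show (j : ℝ) - (j - 1 - i) = i + 1 by ring, abs_of_nonneg (by positivity)]
    rw [e]
    refine (sum_range_inv_sqrt_succ_le j).trans ?_
    gcongr
  have h2 : ∑ i ∈ Finset.Ico j J, 1 / √|(j : ℝ) - i| ≤ 2 * √J := by
    obtain ⟨m, rfl⟩ : ∃ m, J = j + (m + 1) := ⟨J - j - 1, by omega⟩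
    rw [Finset.sum_Ico_eq_sum_range, Nat.add_sub_cancel_left, Finset.sum_range_succ']
    have e : ∀ i : ℕ, 1 / √|(j : ℝ) - (j + (i + 1) : ℕ)| = 1 / √((i : ℝ) + 1) := by
      intro i
      push_cast
      rw [show (j : ℝ) - (j + (i + 1)) = -(i + 1) by ring, abs_neg,
        abs_of_nonneg (by positivity)]
    simp_rw [e]
    simp only [add_zero, sub_self, abs_zero, sqrt_zero, div_zero]
    refine (sum_range_inv_sqrt_succ_le m).trans ?_
    gcongr
    omega
  rw [Finset.range_eq_Ico, ← Finset.sum_Ico_consecutive _ (Nat.zero_le j) hj.le,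
    ← Finset.range_eq_Ico]
  linarith

lemma sum_product_le_of_inv_sqrt {J : ℕ} {A B : ℝ} (hB : 0 ≤ B)
    {p : ℕ × ℕ} (hp : p ∈ Finset.range J ×ˢ Finset.range J) {S : ℕ × ℕ → ℝ}
    (hS : ∀ p' ∈ Finset.range J ×ˢ Finset.range J, S p' ≤ (if p.1 = p'.1 then
      (if p.2 = p'.2 then A else 0) + B * (1 / √|(p.2 : ℝ) - p'.2|) else 0) +
      B * (1 / √|(p.1 : ℝ) - p'.1|)) :
    ∑ p' ∈ Finset.range J ×ˢ Finset.range J, S p' ≤ A + 8 * B * (J * √J) := by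
  obtain ⟨h1, h2⟩ := Finset.mem_product.1 hp
  have hJ : (1 : ℝ) ≤ J := by
    have := Finset.mem_range.1 h1
    exact_mod_cast (by omega)
  refine (Finset.sum_le_sum hS).trans ?_
  rw [Finset.sum_add_distrib, Finset.sum_product, Finset.sum_product]
  have e1 : ∑ j ∈ Finset.range J, ∑ k ∈ Finset.range J, (if p.1 = j then
      (if p.2 = k then A else 0) + B * (1 / √|(p.2 : ℝ) - k|) else 0) =
      A + B * ∑ k ∈ Finset.range J, 1 / √|(p.2 : ℝ) - k| := by
    rw [Finset.sum_comm]
    simp_rw [Finset.sum_ite_eq, if_pos h1, Finset.sum_add_distrib, Finset.sum_ite_eq, if_pos h2,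
      Finset.mul_sum]
  have e2 : ∑ j ∈ Finset.range J, ∑ _k ∈ Finset.range J, B * (1 / √|(p.1 : ℝ) - j|) =
      J * (B * ∑ j ∈ Finset.range J, 1 / √|(p.1 : ℝ) - j|) := by
    simp_rw [Finset.sum_const, Finset.card_range, nsmul_eq_mul, Finset.mul_sum]
  simp only at e1 e2 ⊢
  rw [e1, e2]
  have b1 := sum_range_inv_sqrt_abs_sub_le (Finset.mem_range.1 h1)
  have b2 := sum_range_inv_sqrt_abs_sub_le (Finset.mem_range.1 h2)
  have c1 : (J : ℝ) * (B * ∑ j ∈ Finset.range J, 1 / √|(p.1 : ℝ) - j|) ≤ J * (B * (4 * √J)) := by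
    gcongr
  have c2 : B * ∑ k ∈ Finset.range J, 1 / √|(p.2 : ℝ) - k| ≤ B * (4 * √J) := by gcongr
  have c3 : B * (4 * √J) ≤ J * (B * (4 * √J)) := le_mul_of_one_le_left (by positivity) hJ
  linarith

lemma exists_card_close_le
    {f₁ f₁' f₁'' f₁''' f₂ f₂' f₂'' f₂''' : ℝ → ℝ}
    (hf₁ : ∀ x ∈ Icc (0:ℝ) 1, HasDerivWithinAt f₁ (f₁' x) (Icc (0:ℝ) 1) x)
    (hf₁' : ∀ x ∈ Icc (0:ℝ) 1, HasDerivWithinAt f₁' (f₁'' x) (Icc (0:ℝ) 1) x)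
    (hf₁'' : ∀ x ∈ Icc (0:ℝ) 1, HasDerivWithinAt f₁'' (f₁''' x) (Icc (0:ℝ) 1) x)
    (hf₁''' : ContinuousOn f₁''' (Icc (0:ℝ) 1))
    (hf₂ : ∀ x ∈ Icc (0:ℝ) 1, HasDerivWithinAt f₂ (f₂' x) (Icc (0:ℝ) 1) x)
    (hf₂' : ∀ x ∈ Icc (0:ℝ) 1, HasDerivWithinAt f₂' (f₂'' x) (Icc (0:ℝ) 1) x)
    (hf₂'' : ∀ x ∈ Icc (0:ℝ) 1, HasDerivWithinAt f₂'' (f₂''' x) (Icc (0:ℝ) 1) x)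
    (hf₂''' : ContinuousOn f₂''' (Icc (0:ℝ) 1))
    (htor : ∀ x ∈ Icc (0:ℝ) 1, f₁'' x * f₂''' x - f₂'' x * f₁''' x ≠ 0) :
    ∃ K q₀ : ℝ, 0 < K ∧ 0 < q₀ ∧ ∀ (q J : ℕ) (t : Finset ℕ), 0 < J → J ^ 5 ≤ q → q₀ ≤ q →
      t ⊆ Finset.range (q + 1) → (∀ n ∈ t, ∃ m : ℤ, |q * f₁ (n / q) - m| ≤ 1 / (6 * J)) →
      (∀ n ∈ t, ∃ m : ℤ, |q * f₂ (n / q) - m| ≤ 1 / (6 * J)) →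
      (t.card : ℝ) ≤ K * (q / J ^ 2) := by
  obtain ⟨K, C, hK, hC, hexp⟩ := exists_norm_sum_unitExp_curve_le hf₁ hf₁' hf₁'' hf₁''' hf₂ hf₂'
    hf₂'' hf₂''' htor
  refine ⟨16 * (2 + 8 * K), C ^ 2, by positivity, by positivity, ?_⟩
  intro q J t hJ hJq hq₀ ht hx hy
  have hJ1 : (1 : ℝ) ≤ J := by exact_mod_cast hJ
  have hJ0 : (0 : ℝ) < J := by linarith
  have hJq' : (J : ℝ) ^ 5 ≤ q := by exact_mod_cast hJq
  have hq1 : (1 : ℝ) ≤ q := (one_le_pow₀ hJ1).trans hJq'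
  have hq0 : (0 : ℝ) < q := by linarith
  have hsingle : ∀ j k r : ℝ, |j| ≤ r → |k| ≤ r → (|j| = r ∨ |k| = r) → 1 ≤ r → r ≤ J →
      ‖∑ n ∈ Finset.range (q + 1), unitExp (j * (q * f₁ (n / q)) + k * (q * f₂ (n / q)))‖ ≤
        K * (q / J ^ 2 * √J) * (1 / √r) := by
    intro j k r hj hk hjk hr hrJ
    have hr0 : 0 < r := by linarith
    set T : ℝ := q / J ^ 2 * √J * (1 / √r) with hT
    have hT0 : 0 < T := by positivity
    have hTsq : T ^ 2 = q ^ 2 / (J ^ 3 * r) := by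
      rw [hT, mul_pow, mul_pow, div_pow, div_pow, sq_sqrt hJ0.le, sq_sqrt hr0.le]
      field_simp
    have hrT : r * T ^ 2 = q ^ 2 / J ^ 3 := by
      rw [hTsq]
      field_simp
    have hTJ : (J : ℝ) ^ 3 ≤ T := by
      have h1 : (J : ℝ) ^ 3 ≤ q / J ^ 2 := by
        rw [le_div_iff₀ (by positivity)]
        calc (J : ℝ) ^ 3 * J ^ 2 = J ^ 5 := by ring
          _ ≤ (q : ℝ) := hJq'
      have h2 : 1 ≤ √J * (1 / √r) := by
        rw [mul_one_div, le_div_iff₀ (by positivity), one_mul]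
        exact sqrt_le_sqrt hrJ
      rw [hT, mul_assoc]
      exact h1.trans (le_mul_of_one_le_right (by positivity) h2)
    have hT1 : 1 ≤ T := (one_le_pow₀ hJ1).trans hTJ
    have h := hexp j k r T q hj hk hjk hr ?_ ?_ ?_ ?_ hT1
    · have e : ∀ n : ℕ, (q : ℝ) * (j * f₁ (n / q) + k * f₂ (n / q)) =
          j * (q * f₁ (n / q)) + k * (q * f₂ (n / q)) := fun n => by ring
      simp_rw [e] at h
      rwa [hT, ← mul_assoc] at h
    · have h1 : (C * r) ^ 2 ≤ (q : ℝ) ^ 2 := by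
        calc (C * r) ^ 2 = C ^ 2 * r ^ 2 := by ring
          _ ≤ (q : ℝ) * J ^ 2 := by gcongr
          _ ≤ (q : ℝ) * J ^ 5 := by
            gcongr
            norm_num
          _ ≤ (q : ℝ) * q := by gcongr
          _ = (q : ℝ) ^ 2 := by ring
      exact (abs_le_of_sq_le_sq' h1 hq0.le).2
    · rw [hTsq, le_div_iff₀ (by positivity)]
      calc r * q * (J ^ 3 * r) = (q : ℝ) * (J ^ 3 * r ^ 2) := by ring
        _ ≤ (q : ℝ) * (J ^ 3 * J ^ 2) := by gcongr
        _ = (q : ℝ) * J ^ 5 := by ring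
        _ ≤ (q : ℝ) * q := by gcongr
        _ = (q : ℝ) ^ 2 := by ring
    · calc (q : ℝ) ^ 2 = q ^ 2 / J ^ 3 * J ^ 3 := by field_simp
        _ ≤ q ^ 2 / J ^ 3 * T := by gcongr
        _ = r * T ^ 3 := by rw [← hrT]; ring
    · rw [hrT]
      exact div_le_self (by positivity) (one_le_pow₀ hJ1)
  set B := K * (q / J ^ 2 * √J) with hB
  have hB0 : 0 ≤ B := by positivity
  have hsqrt : ∀ s r : ℝ, 0 < s → s ≤ r → B * (1 / √r) ≤ B * (1 / √s) := fun s r hs hsr => by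
    gcongr
  have hint : ∀ i j : ℕ, i ≠ j → 1 ≤ |(i : ℝ) - j| := by
    intro i j hij
    have : (1 : ℤ) ≤ |(i : ℤ) - j| := Int.one_le_abs (by omega)
    exact_mod_cast this
  have hle : ∀ i j : ℕ, i < J → j < J → |(i : ℝ) - j| ≤ J := by
    intro i j hi hj
    have h1 : (i : ℝ) < J := by exact_mod_cast hi
    have h2 : (j : ℝ) < J := by exact_mod_cast hj
    rw [abs_le]
    constructor <;> linarith [Nat.cast_nonneg (α := ℝ) i, Nat.cast_nonneg (α := ℝ) j]
  have hrow : ∀ p ∈ Finset.range J ×ˢ Finset.range J,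
      ∑ p' ∈ Finset.range J ×ˢ Finset.range J, ‖∑ n ∈ Finset.range (q + 1),
        unitExp (((p.1 : ℝ) - p'.1) * (q * f₁ (n / q)) + ((p.2 : ℝ) - p'.2) * (q * f₂ (n / q)))‖
      ≤ (2 + 8 * K) * q := by
    intro p hp
    have hpr := Finset.mem_product.1 hp
    rw [Finset.mem_range, Finset.mem_range] at hpr
    refine (sum_product_le_of_inv_sqrt (A := 2 * q) hB0 hp fun p' hp' => ?_).trans (le_of_eq ?_)
    · have hpr' := Finset.mem_product.1 hp'
      rw [Finset.mem_range, Finset.mem_range] at hpr'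
      have hmax : (p.1 ≠ p'.1 ∨ p.2 ≠ p'.2) → ‖∑ n ∈ Finset.range (q + 1),
          unitExp (((p.1 : ℝ) - p'.1) * (q * f₁ (n / q)) +
            ((p.2 : ℝ) - p'.2) * (q * f₂ (n / q)))‖ ≤
          B * (1 / √(max |(p.1 : ℝ) - p'.1| |(p.2 : ℝ) - p'.2|)) := by
        intro hne
        refine hsingle _ _ _ (le_max_left _ _) (le_max_right _ _) ?_ ?_ ?_
        · rcases max_choice |(p.1 : ℝ) - p'.1| |(p.2 : ℝ) - p'.2| with h | h
          · exact Or.inl h.symm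
          · exact Or.inr h.symm
        · rcases hne with h | h
          · exact (hint _ _ h).trans (le_max_left _ _)
          · exact (hint _ _ h).trans (le_max_right _ _)
        · exact max_le (hle _ _ hpr.1 hpr'.1) (hle _ _ hpr.2 hpr'.2)
      by_cases h1 : p.1 = p'.1
      · by_cases h2 : p.2 = p'.2
        · rw [if_pos h1, if_pos h2, h1, h2]
          simp only [sub_self, abs_zero, sqrt_zero, div_zero, mul_zero, add_zero]
          refine (norm_sum_unitExp_le_card _ _).trans ?_
          rw [Finset.card_range]
          push_cast
          linarith
        · rw [if_pos h1, if_neg h2, zero_add]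
          refine (hmax (Or.inr h2)).trans ((hsqrt _ _ ?_ (le_max_right _ _)).trans ?_)
          · linarith [hint _ _ h2]
          · have : 0 ≤ B * (1 / √|(p.1 : ℝ) - p'.1|) := by positivity
            linarith
      · rw [if_neg h1, zero_add]
        refine (hmax (Or.inl h1)).trans (hsqrt _ _ ?_ (le_max_left _ _))
        linarith [hint _ _ h1]
    · have h : √(J : ℝ) ^ 2 = J := sq_sqrt hJ0.le
      have e : B * (J * √J) = K * q := by
        calc B * (J * √J) = K * (q / J ^ 2 * J) * √J ^ 2 := by rw [hB]; ring
          _ = K * q := by rw [h]; field_simp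
      rw [mul_assoc 8 B, e]
      ring
  have h := (card_mul_le_sum_norm_sum_unitExp _ t ht (fun n => q * f₁ (n / q))
    (fun n => q * f₂ (n / q)) hJ hx hy).trans (Finset.sum_le_card_nsmul _ _ _ hrow)
  rw [Finset.card_product, Finset.card_range, nsmul_eq_mul] at h
  push_cast at h
  have e : 16 * (2 + 8 * K) * (q / (J : ℝ) ^ 2) =
      J * J * ((2 + 8 * K) * q) / ((J : ℝ) / 2) ^ 4 := by
    field_simp
    norm_num
  rw [e, le_div_iff₀ (by positivity)]
  exact h

theorem integral_points_close_to_space_curve_upper_bound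
    (f₁ f₁' f₁'' f₁''' f₂ f₂' f₂'' f₂''' : ℝ → ℝ)
    (hf₁ : ∀ x ∈ Icc (0:ℝ) 1, HasDerivWithinAt f₁ (f₁' x) (Icc (0:ℝ) 1) x)
    (hf₁' : ∀ x ∈ Icc (0:ℝ) 1, HasDerivWithinAt f₁' (f₁'' x) (Icc (0:ℝ) 1) x)
    (hf₁'' : ∀ x ∈ Icc (0:ℝ) 1, HasDerivWithinAt f₁'' (f₁''' x) (Icc (0:ℝ) 1) x)
    (hf₁''' : ContinuousOn f₁''' (Icc (0:ℝ) 1))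
    (hf₂ : ∀ x ∈ Icc (0:ℝ) 1, HasDerivWithinAt f₂ (f₂' x) (Icc (0:ℝ) 1) x)
    (hf₂' : ∀ x ∈ Icc (0:ℝ) 1, HasDerivWithinAt f₂' (f₂'' x) (Icc (0:ℝ) 1) x)
    (hf₂'' : ∀ x ∈ Icc (0:ℝ) 1, HasDerivWithinAt f₂'' (f₂''' x) (Icc (0:ℝ) 1) x)
    (hf₂''' : ContinuousOn f₂''' (Icc (0:ℝ) 1))
    (htor : ∀ x ∈ Icc (0:ℝ) 1, f₁'' x * f₂''' x - f₂'' x * f₁''' x ≠ 0) :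
    ∃ K : ℝ, 0 < K ∧ ∀ q : ℕ, 2 ≤ q → ∀ δ : ℝ, 0 < δ → δ < 1/2 →
      ({a : ℤ | 0 ≤ a ∧ (a : ℝ) ≤ q ∧
          nint ((q : ℝ) * f₁ ((a : ℝ) / q)) < δ ∧
          nint ((q : ℝ) * f₂ ((a : ℝ) / q)) < δ}.ncard : ℝ)
        ≤ K * (δ ^ 2 * q + (q : ℝ) ^ ((3 : ℝ)/5) * (Real.log q) ^ ((4 : ℝ)/5)) := by
  obtain ⟨K, q₀, hK, hq₀, hcard⟩ := exists_card_close_le hf₁ hf₁' hf₁'' hf₁''' hf₂ hf₂'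
    hf₂'' hf₂''' htor
  refine ⟨144 * K + 72 + 4 * q₀, by positivity, ?_⟩
  intro q hq δ hδ _
  have hq2 : (2 : ℝ) ≤ q := by exact_mod_cast hq
  have hq0 : (0 : ℝ) < q := by linarith
  set t : Finset ℕ := (Finset.range (q + 1)).filter fun n =>
    nint ((q : ℝ) * f₁ ((n : ℝ) / q)) < δ ∧ nint ((q : ℝ) * f₂ ((n : ℝ) / q)) < δ with ht
  have hncard : {a : ℤ | 0 ≤ a ∧ (a : ℝ) ≤ q ∧ nint ((q : ℝ) * f₁ ((a : ℝ) / q)) < δ ∧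
      nint ((q : ℝ) * f₂ ((a : ℝ) / q)) < δ}.ncard ≤ t.card := by
    have hsub : {a : ℤ | 0 ≤ a ∧ (a : ℝ) ≤ q ∧ nint ((q : ℝ) * f₁ ((a : ℝ) / q)) < δ ∧
        nint ((q : ℝ) * f₂ ((a : ℝ) / q)) < δ} ⊆ (t.image (fun n : ℕ => (n : ℤ)) : Finset ℤ) := by
      rintro a ⟨h0, h1, h2⟩
      lift a to ℕ using h0
      rw [Finset.coe_image]
      refine ⟨a, ?_, rfl⟩
      have h3 : a ≤ q := by exact_mod_cast h1
      rw [ht, Finset.mem_coe, Finset.mem_filter, Finset.mem_range]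
      exact ⟨by omega, by simpa using h2⟩
    refine (Set.ncard_le_ncard hsub (Finset.finite_toSet _)).trans ?_
    rw [Set.ncard_coe_finset]
    exact Finset.card_image_le
  have hncard' : (({a : ℤ | 0 ≤ a ∧ (a : ℝ) ≤ q ∧ nint ((q : ℝ) * f₁ ((a : ℝ) / q)) < δ ∧
      nint ((q : ℝ) * f₂ ((a : ℝ) / q)) < δ}.ncard : ℕ) : ℝ) ≤ t.card := by exact_mod_cast hncard
  refine hncard'.trans ?_
  have htriv : (t.card : ℝ) ≤ 2 * q := by
    have h1 : t.card ≤ q + 1 := (Finset.card_filter_le _ _).trans (Finset.card_range _).le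
    have h2 : (t.card : ℝ) ≤ q + 1 := by exact_mod_cast h1
    linarith
  set ξ : ℝ := (q : ℝ) ^ ((1 : ℝ) / 5) with hξ
  have hξ5 : ξ ^ 5 = q := by
    rw [hξ, ← rpow_natCast, ← rpow_mul hq0.le]
    norm_num
  have hξ3 : (q : ℝ) ^ ((3 : ℝ) / 5) = ξ ^ 3 := by
    rw [hξ, ← rpow_natCast, ← rpow_mul hq0.le]
    norm_num
  have hξ1 : 1 ≤ ξ := one_le_rpow (by linarith) (by norm_num)
  have hlog : 1 / 2 ≤ (Real.log q) ^ ((4 : ℝ) / 5) := by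
    have h1 : 1 / 2 ≤ Real.log q := by
      have := log_two_gt_d9
      have h2 := log_le_log (by norm_num) hq2
      linarith
    calc (1 / 2 : ℝ) = (1 / 2) ^ (1 : ℝ) := (rpow_one _).symm
      _ ≤ (1 / 2) ^ ((4 : ℝ) / 5) :=
        rpow_le_rpow_of_exponent_ge (by norm_num) (by norm_num) (by norm_num)
      _ ≤ _ := rpow_le_rpow (by norm_num) h1 (by norm_num)
  rw [hξ3]
  have hξpos : 1 ≤ ξ ^ 3 := one_le_pow₀ hξ1
  have hE : ξ ^ 3 / 2 ≤ ξ ^ 3 * (Real.log q) ^ ((4 : ℝ) / 5) := by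
    have := mul_le_mul_of_nonneg_left hlog (by positivity : 0 ≤ ξ ^ 3)
    linarith
  set E := ξ ^ 3 * (Real.log q) ^ ((4 : ℝ) / 5) with hEdef
  have hD : 0 < δ ^ 2 * q := by positivity
  have hE0 : 1 / 2 ≤ E := by linarith
  rcases le_or_gt q₀ q with hq₀q | hq₀q
  swap
  · have h1 : 4 * q₀ * (1 / 2) ≤ 4 * q₀ * (δ ^ 2 * q + E) := by
      gcongr
      linarith
    have h2 : 0 ≤ (144 * K + 72) * (δ ^ 2 * q + E) := by positivity
    linarith
  rcases le_or_gt δ (1 / 6) with hδ6 | hδ6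
  swap
  · have h1 : 2 * (q : ℝ) ≤ 72 * (δ ^ 2 * q) := by
      have : (1 / 6 : ℝ) ^ 2 ≤ δ ^ 2 := by gcongr
      nlinarith
    have h2 : 0 ≤ (144 * K + 4 * q₀) * (δ ^ 2 * q + E) := by positivity
    linarith
  set x := min (1 / (6 * δ)) ξ with hx
  have hx1 : 1 ≤ x := by
    refine le_min ?_ hξ1
    rw [le_div_iff₀ (by positivity)]
    linarith
  set J := ⌊x⌋₊ with hJ
  have hJ1 : 1 ≤ J := Nat.le_floor (by exact_mod_cast hx1)
  have hJ1' : (1 : ℝ) ≤ J := by exact_mod_cast hJ1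
  have hJx : (J : ℝ) ≤ x := Nat.floor_le (by linarith)
  have hxJ : x ≤ 2 * J := by linarith [Nat.lt_floor_add_one x]
  have hJδ : δ ≤ 1 / (6 * J) := by
    have h1 : (J : ℝ) ≤ 1 / (6 * δ) := hJx.trans (min_le_left _ _)
    rw [le_div_iff₀ (by positivity)] at h1 ⊢
    linarith
  have hJ5 : J ^ 5 ≤ q := by
    have h1 : (J : ℝ) ^ 5 ≤ q := by
      rw [← hξ5]
      have : (J : ℝ) ≤ ξ := hJx.trans (min_le_right _ _)
      gcongr
    exact_mod_cast h1
  have h := hcard q J t hJ1 hJ5 hq₀q (Finset.filter_subset _ _)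
    (fun n hn => ⟨round ((q : ℝ) * f₁ ((n : ℝ) / q)),
      ((Finset.mem_filter.1 hn).2.1.le).trans hJδ⟩)
    (fun n hn => ⟨round ((q : ℝ) * f₂ ((n : ℝ) / q)),
      ((Finset.mem_filter.1 hn).2.2.le).trans hJδ⟩)
  have hmain : q / (J : ℝ) ^ 2 ≤ 144 * (δ ^ 2 * q + E) := by
    have h1 : q / (J : ℝ) ^ 2 ≤ 4 * (q / x ^ 2) := by
      rw [← mul_div_assoc, div_le_div_iff₀ (by positivity) (by positivity)]
      have : x ^ 2 ≤ (2 * J) ^ 2 := by gcongr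
      nlinarith
    have h2 : q / x ^ 2 ≤ 36 * (δ ^ 2 * q) + ξ ^ 3 := by
      rcases min_choice (1 / (6 * δ)) ξ with h | h
      · rw [hx, h]
        have e : (q : ℝ) / (1 / (6 * δ)) ^ 2 = 36 * (δ ^ 2 * q) := by
          field_simp
          norm_num
        rw [e]
        linarith
      · rw [hx, h]
        have e : (q : ℝ) / ξ ^ 2 = ξ ^ 3 := by
          rw [← hξ5]
          field_simp
        rw [e]
        linarith
    linarith
  have h3 : K * (q / (J : ℝ) ^ 2) ≤ K * (144 * (δ ^ 2 * q + E)) := by gcongr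
  have h4 : 0 ≤ (72 + 4 * q₀) * (δ ^ 2 * q + E) := by positivity
  linarith
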